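/- arXiv:1407.7623 — 5 statements merged into one kernel-verified Lean document; each statement's English description precedes it below -/
import Mathlib

section
/- Let (E, μ) be a probability space, T : E → E an ergodic measure-preserving transformation, and ω ↦ κ(ω) a measurable kernel assigning to each ω ∈ E a nonzero finite Borel measure on ℝ. For t ∈ ℝ set m_t(ω) = ∫ e^{tx} κ(ω)(dx). Assume that for every t ∈ ℝ: for μ-a.e. ω one has 0 < m_t(ω) < ∞ and ∫ |x| e^{tx} κ(ω)(dx) < ∞, and moreover ∫_E |log m_t(ω)| μ(dω) < ∞ and ∫_E |(∫ x e^{tx} κ(ω)(dx)) / m_t(ω)| μ(dω) < ∞. Define Λ(t) = ∫_E log m_t(ω) μ(dω) and let Λ* be the Legendre transform of Λ. Then for μ-a.e. ω the following holds: for every Borel set A ⊆ ℝ, writing q_n = κ(ω) ∗ κ(Tω) ∗ ⋯ ∗ κ(T^{n−1}ω), one has −inf_{x ∈ interior(A)} Λ*(x) ≤ liminf_{n→∞} (1/n) log q_n({y ∈ ℝ : y/n ∈ A}) ≤ limsup_{n→∞} (1/n) log q_n({y ∈ ℝ : y/n ∈ A}) ≤ −inf_{x ∈ closure(A)} Λ*(x).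 -/
open MeasureTheory Filter Topology Set

def bmax {E : Type*} (T : E → E) (f : E → ℝ) : ℕ → E → ℝ
  | 0 => f
  | n + 1 => fun x => f x + max 0 (bmax T f n (T x))

lemma bmax_ge {E : Type*} (T : E → E) (f : E → ℝ) (n : ℕ) (x : E) : f x ≤ bmax T f n x := by
  cases n with
  | zero => simp [bmax]
  | succ n => simp [bmax]

lemma bmax_succ {E : Type*} (T : E → E) (f : E → ℝ) (n : ℕ) : ∀ (x : E), bmax T f n x ≤ bmax T f (n+1) x := by
  induction n with
  | zero => intro x; simp [bmax]
  | succ n ih =>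
    intro x
    change f x + max 0 (bmax T f n (T x)) ≤ f x + max 0 (bmax T f (n+1) (T x))
    have := ih (T x)
    gcongr

lemma bmax_sum {E : Type*} (T : E → E) (f : E → ℝ) (k : ℕ) :
    ∀ (n : ℕ) (x : E), k ≤ n → birkhoffSum T f (k+1) x ≤ bmax T f n x := by
  induction k with
  | zero => intro n x _; simpa [birkhoffSum] using bmax_ge T f n x
  | succ k ih =>
    intro n x hn
    obtain ⟨n, rfl⟩ : ∃ p, n = p + 1 := ⟨n - 1, by omega⟩
    rw [birkhoffSum_succ' T f (k+1) x]
    have := ih n (T x) (by omega)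
    change _ ≤ f x + max 0 (bmax T f n (T x))
    have := le_max_right 0 (bmax T f n (T x))
    linarith

lemma bmax_int {E : Type*} [MeasurableSpace E] {μ : Measure E} {T : E → E}
    (hT : MeasurePreserving T μ μ) {f : E → ℝ} (hf : Integrable f μ) (n : ℕ) :
    Integrable (bmax T f n) μ := by
  induction n with
  | zero => exact hf
  | succ n ih =>
    have h1 : Integrable (fun x => bmax T f n (T x)) μ := hT.integrable_comp_of_integrable ih
    have := hf.add ((integrable_zero E ℝ μ).sup h1)
    exact this

lemma birkhoff_bdd {E : Type*} [MeasurableSpace E] {μ : Measure E} [IsProbabilityMeasure μ]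
    {T : E → E} (hT : Ergodic T μ) {f : E → ℝ} (hf : Integrable f μ) (hfm : Measurable f)
    (hneg : ∫ x, f x ∂μ < 0) :
    ∀ᵐ x ∂μ, BddAbove (range fun n => birkhoffSum T f n x) := by
  have hTm := hT.measurable
  have hSm : ∀ n, Measurable (birkhoffSum T f n) := by
    intro n
    unfold birkhoffSum
    exact Finset.measurable_sum _ fun i _ => hfm.comp (hTm.iterate i)
  set A : Set E := {x | BddAbove (range fun n => birkhoffSum T f n x)} with hA
  have hAm : MeasurableSet A := measurableSet_bddAbove_range hSm
  have hinv : T ⁻¹' A = A := by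
    ext x
    simp only [hA, mem_preimage, mem_ofPred_eq]
    constructor
    · rintro ⟨C, hC⟩
      refine ⟨max 0 (f x + C), ?_⟩
      rintro _ ⟨n, rfl⟩
      cases n with
      | zero => simp
      | succ n =>
        simp only
        rw [birkhoffSum_succ']
        have := hC ⟨n, rfl⟩
        simp only at this
        exact le_max_of_le_right (by linarith)
    · rintro ⟨C, hC⟩
      refine ⟨C - f x, ?_⟩
      rintro _ ⟨n, rfl⟩
      have := hC ⟨n+1, rfl⟩
      simp only at this
      rw [birkhoffSum_succ'] at this
      simp only
      linarith
  rcases hT.toPreErgodic.ae_empty_or_univ hAm hinv with h | h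
  swap
  · filter_upwards [h.mem_iff] with x hx
    have : x ∈ A := hx.2 (mem_univ x)
    simpa [hA] using this
  exfalso
  have hlim : Tendsto (fun n => ∫ x, (bmax T f (n+1) x - bmax T f n (T x)) ∂μ) atTop
      (𝓝 (∫ x, f x ∂μ)) := by
    have hfT : Integrable (fun x => f (T x)) μ := hT.toMeasurePreserving.integrable_comp_of_integrable hf
    refine tendsto_integral_of_dominated_convergence (fun x => |f x| + |f (T x)|) ?_ ?_ ?_ ?_
    · intro n
      exact ((bmax_int hT.toMeasurePreserving hf (n+1)).sub
        (hT.toMeasurePreserving.integrable_comp_of_integrable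
          (bmax_int hT.toMeasurePreserving hf n))).1
    · exact hf.abs.add hfT.abs
    · intro n
      refine ae_of_all _ fun x => ?_
      change |f x + max 0 (bmax T f n (T x)) - bmax T f n (T x)| ≤ _
      have h1 := bmax_ge T f n (T x)
      have h2 := neg_abs_le (f (T x))
      have h3 := abs_le.1 (le_refl |f x|)
      have h4 := abs_nonneg (f (T x))
      rcases le_total 0 (bmax T f n (T x)) with h | h
      · rw [max_eq_right h, abs_le]; constructor <;> linarith
      · rw [max_eq_left h, abs_le]; constructor <;> linarith
    · filter_upwards [h.mem_iff] with x hx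
      have hx' : ¬ x ∈ A := fun hh => hx.1 hh
      rw [← hinv] at hx'
      have h0 : ∃ k, 0 < birkhoffSum T f (k+1) (T x) := by
        by_contra! hc
        apply hx'
        refine ⟨0, ?_⟩
        rintro _ ⟨n, rfl⟩
        cases n with
        | zero => simp
        | succ n => exact hc n
      obtain ⟨k, hk⟩ := h0
      apply tendsto_const_nhds.congr'
      filter_upwards [eventually_ge_atTop k] with n hn
      have := bmax_sum T f k n (T x) hn
      change _ = f x + max 0 (bmax T f n (T x)) - bmax T f n (T x)
      rw [max_eq_right (by linarith)]; ring
  have hge : ∀ n, 0 ≤ ∫ x, (bmax T f (n+1) x - bmax T f n (T x)) ∂μ := by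
    intro n
    have i1 := bmax_int hT.toMeasurePreserving hf n
    have i2 := bmax_int hT.toMeasurePreserving hf (n+1)
    have i3 : Integrable (fun x => bmax T f n (T x)) μ :=
      hT.toMeasurePreserving.integrable_comp_of_integrable i1
    rw [integral_sub i2 i3]
    have : ∫ x, bmax T f n (T x) ∂μ = ∫ x, bmax T f n x ∂μ := by
      have := integral_map (μ := μ) hTm.aemeasurable (f := bmax T f n) (by rw [hT.map_eq]; exact i1.1)
      rw [hT.map_eq] at this
      exact this.symm
    rw [this, sub_nonneg]
    exact integral_mono i1 i2 (bmax_succ T f n)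
  have := ge_of_tendsto' hlim hge
  linarith

lemma birkhoff_upper {E : Type*} [MeasurableSpace E] {μ : Measure E} [IsProbabilityMeasure μ]
    {T : E → E} (hT : Ergodic T μ) {f : E → ℝ} (hf : Integrable f μ) (hfm : Measurable f) :
    ∀ᵐ x ∂μ, ∀ ε > 0, ∀ᶠ n : ℕ in atTop, (n:ℝ)⁻¹ * birkhoffSum T f n x ≤ ∫ x, f x ∂μ + ε := by
  have key : ∀ k : ℕ, ∀ᵐ x ∂μ, BddAbove (range fun n => birkhoffSum T (fun x => f x - (∫ x, f x ∂μ + 1/((k:ℝ)+1))) n x) := by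
    intro k
    apply birkhoff_bdd hT (hf.sub (integrable_const _)) (hfm.sub_const _)
    change ∫ x, (f x - (∫ x, f x ∂μ + 1/((k:ℝ)+1))) ∂μ < 0
    rw [integral_sub hf (integrable_const _)]
    have : 0 < 1/((k:ℝ)+1) := by positivity
    simp
    positivity
  filter_upwards [ae_all_iff.2 key] with x hx ε hε
  obtain ⟨k, hk⟩ := exists_nat_one_div_lt (half_pos hε)
  obtain ⟨C, hC⟩ := hx k
  have h2 : ∀ᶠ n : ℕ in atTop, (n:ℝ)⁻¹ * C < ε / 2 := by
    have : Tendsto (fun n : ℕ => (n:ℝ)⁻¹ * C) atTop (𝓝 (0 * C)) :=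
      tendsto_inv_atTop_nhds_zero_nat.mul_const C
    rw [zero_mul] at this
    exact this.eventually_lt_const (half_pos hε)
  filter_upwards [h2, eventually_gt_atTop 0] with n hn hn0
  have h3 := hC ⟨n, rfl⟩
  have hn0' : (0:ℝ) < n := by exact_mod_cast hn0
  simp only [birkhoffSum, Finset.sum_sub_distrib, Finset.sum_const, Finset.card_range, nsmul_eq_mul] at h3 ⊢
  have h4 : (n:ℝ)⁻¹ * ∑ i ∈ Finset.range n, f (T^[i] x) ≤ (n:ℝ)⁻¹ * (C + n * (∫ x, f x ∂μ + 1/((k:ℝ)+1))) := by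
    gcongr; linarith
  rw [mul_add, ← mul_assoc, inv_mul_cancel₀ hn0'.ne'] at h4
  linarith

lemma birkhoff_tendsto {E : Type*} [MeasurableSpace E] {μ : Measure E} [IsProbabilityMeasure μ]
    {T : E → E} (hT : Ergodic T μ) {f : E → ℝ} (hf : Integrable f μ) (hfm : Measurable f) :
    ∀ᵐ x ∂μ, Tendsto (fun n : ℕ => (n:ℝ)⁻¹ * birkhoffSum T f n x) atTop (𝓝 (∫ x, f x ∂μ)) := by
  filter_upwards [birkhoff_upper hT hf hfm, birkhoff_upper hT hf.neg hfm.neg] with x h1 h2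
  rw [Metric.tendsto_nhds]
  intro ε hε
  filter_upwards [h1 _ (half_pos hε), h2 _ (half_pos hε)] with n h3 h4
  simp only [Pi.neg_apply, integral_neg, birkhoffSum, Finset.sum_neg_distrib] at h3 h4 ⊢
  rw [Real.dist_eq, abs_lt]
  constructor <;> linarith

lemma ereal_le_aux {n : ℕ} (hn : 0 < n) {Q : ENNReal} {b : ℝ}
    (h : Q ≤ ENNReal.ofReal (Real.exp (n * b))) :
    (((n : ℝ)⁻¹ : ℝ) : EReal) * ENNReal.log Q ≤ (b : EReal) := by
  have hn' : (0:ℝ) < n := by exact_mod_cast hn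
  have h1 : ENNReal.log Q ≤ ((n * b : ℝ) : EReal) := by
    refine (ENNReal.log_monotone h).trans ?_
    rw [ENNReal.log_ofReal_of_pos (Real.exp_pos _), Real.log_exp]
  calc (((n : ℝ)⁻¹ : ℝ) : EReal) * ENNReal.log Q
      ≤ (((n : ℝ)⁻¹ : ℝ) : EReal) * ((n * b : ℝ) : EReal) :=
        mul_le_mul_of_nonneg_left h1 (by exact_mod_cast (inv_pos.2 hn').le)
    _ = b := by
        rw [← EReal.coe_mul]; congr 1; field_simp

lemma ereal_ge_aux {n : ℕ} (hn : 0 < n) {Q : ENNReal} {b : ℝ}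
    (h : ENNReal.ofReal (Real.exp (n * b)) ≤ Q) :
    (b : EReal) ≤ (((n : ℝ)⁻¹ : ℝ) : EReal) * ENNReal.log Q := by
  have hn' : (0:ℝ) < n := by exact_mod_cast hn
  have h1 : ((n * b : ℝ) : EReal) ≤ ENNReal.log Q := by
    refine le_trans ?_ (ENNReal.log_monotone h)
    rw [ENNReal.log_ofReal_of_pos (Real.exp_pos _), Real.log_exp]
  calc (b : EReal) = (((n : ℝ)⁻¹ : ℝ) : EReal) * ((n * b : ℝ) : EReal) := by
        rw [← EReal.coe_mul]; congr 1; field_simp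
    _ ≤ _ := mul_le_mul_of_nonneg_left h1 (by exact_mod_cast (inv_pos.2 hn').le)

lemma ev_exp_le {M : ℕ → ℝ} {L : ℝ} (hpos : ∀ n, 0 < M n)
    (hlim : Tendsto (fun n : ℕ => (n:ℝ)⁻¹ * Real.log (M n)) atTop (𝓝 L)) {η : ℝ} (hη : 0 < η) :
    ∀ᶠ n : ℕ in atTop, Real.exp (n * (L - η)) ≤ M n ∧ M n ≤ Real.exp (n * (L + η)) := by
  filter_upwards [hlim.eventually_lt_const (show L < L + η by linarith),
    hlim.eventually_const_lt (show L - η < L by linarith), eventually_gt_atTop 0] with n h1 h2 hn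
  have hn' : (0:ℝ) < n := by exact_mod_cast hn
  rw [← Real.le_log_iff_exp_le (hpos n), ← Real.log_le_iff_le_exp (hpos n)]
  rw [inv_mul_lt_iff₀ hn'] at h1
  rw [lt_inv_mul_iff₀ hn'] at h2
  exact ⟨h2.le, h1.le⟩

lemma ev_exp_small {θ : ℝ} (hθ : 0 < θ) {c : ℝ} (hc : 0 < c) :
    ∀ᶠ n : ℕ in atTop, Real.exp (-(n * θ)) ≤ c := by
  have h : Tendsto (fun n : ℕ => Real.exp (-((n:ℝ) * θ))) atTop (𝓝 0) := by
    apply Real.tendsto_exp_neg_atTop_nhds_zero.comp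
    exact tendsto_natCast_atTop_atTop.atTop_mul_const hθ
  exact h.eventually_le_const hc

/-- perturbed minimization -/
lemma exists_exposed {Λ Λ' : ℝ → ℝ} (hd : ∀ t, HasDerivAt Λ (Λ' t) t) {x V : ℝ}
    (hV : ∀ t, t * x - Λ t ≤ V) {δ : ℝ} (hδ : 0 < δ) :
    ∃ t, |Λ' t - x| < δ ∧ t * Λ' t - Λ t ≤ V := by
  have hC : 0 ≤ Λ 0 + V := by have := hV 0; linarith
  obtain ⟨ε, hε, hε2⟩ : ∃ ε > 0, 2 * ε * (Λ 0 + V) < δ ^ 2 := by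
    refine ⟨δ^2 / (2 * (Λ 0 + V + 1)), by positivity, ?_⟩
    rw [show 2 * (δ^2 / (2 * (Λ 0 + V + 1))) * (Λ 0 + V) = δ^2 * ((Λ 0 + V) / (Λ 0 + V + 1)) by
      field_simp]
    have : (Λ 0 + V) / (Λ 0 + V + 1) < 1 := by rw [div_lt_one (by positivity)]; linarith
    have h2 : 0 < δ^2 := by positivity
    nlinarith
  set f : ℝ → ℝ := fun t => Λ t - t * x + ε * t^2 / 2 with hf
  have hfd : ∀ t, HasDerivAt f (Λ' t - x + ε * t) t := by
    intro t
    have h1 := ((hd t).sub ((hasDerivAt_id t).mul_const x)).add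
      ((((hasDerivAt_id t).pow 2).const_mul ε).div_const 2)
    refine h1.congr_deriv ?_
    simp; ring
  have hfc : Continuous f := continuous_iff_continuousAt.2 fun t => (hfd t).continuousAt
  have hlow : ∀ t, -V + ε * t^2/2 ≤ f t := by
    intro t; have := hV t; simp only [hf]; linarith
  have hco : Tendsto f (cocompact ℝ) atTop := by
    refine tendsto_atTop_mono hlow ?_
    apply tendsto_atTop_add_const_left
    have h1 : Tendsto (fun t : ℝ => ‖t‖ ^ 2) (cocompact ℝ) atTop :=
      (tendsto_pow_atTop (by norm_num)).comp (tendsto_norm_cocompact_atTop (E := ℝ))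
    have h2 := (h1.const_mul_atTop hε).atTop_div_const (show (0:ℝ) < 2 by norm_num)
    simpa using h2
  obtain ⟨t, ht⟩ := hfc.exists_forall_le hco
  have hz : Λ' t - x + ε * t = 0 :=
    IsLocalMin.hasDerivAt_eq_zero (Filter.Eventually.of_forall ht) (hfd t)
  have h0 : f t ≤ Λ 0 := by simpa [hf] using ht 0
  have h1 := hlow t
  refine ⟨t, ?_, ?_⟩
  · have : Λ' t - x = -(ε * t) := by linarith
    rw [this, abs_neg]
    apply abs_lt_of_sq_lt_sq _ hδ.le
    nlinarith
  · have : Λ' t = x - ε * t := by linarith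
    have h3 := hV t
    rw [this]
    nlinarith [mul_nonneg hε.le (sq_nonneg t)]

lemma ge_lower {q : ℕ → Measure ℝ} [∀ n, IsFiniteMeasure (q n)]
    (hint : ∀ n s, Integrable (fun y => Real.exp (s * y)) (q n))
    (hpos : ∀ n s, 0 < ∫ y, Real.exp (s * y) ∂(q n)) {Λ : ℝ → ℝ}
    (hlim : ∀ s, Tendsto (fun n : ℕ => (n:ℝ)⁻¹ * Real.log (∫ y, Real.exp (s * y) ∂(q n))) atTop (𝓝 (Λ s)))
    {t c : ℝ} (hd : HasDerivAt Λ c t) {δ η : ℝ} (hδ : 0 < δ) (hη : 0 < η) :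
    ∀ᶠ n : ℕ in atTop, Real.exp (n * (Λ t - t * c - |t| * δ - η)) ≤ (q n).real {y | |y / n - c| < δ} := by
  obtain ⟨h, hh, hu, hl⟩ : ∃ h > 0, Λ (t + h) - Λ t - h * c ≤ h * δ / 2 ∧
      Λ (t - h) - Λ t + h * c ≤ h * δ / 2 := by
    have h1 := (hasDerivAt_iff_isLittleO.1 hd).def (half_pos hδ)
    rw [Metric.eventually_nhds_iff] at h1
    obtain ⟨r, hr, h2⟩ := h1
    refine ⟨r/2, by positivity, ?_, ?_⟩
    · have := h2 (y := t + r/2) (by simp [abs_of_pos hr]; linarith)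
      simp only [add_sub_cancel_left, smul_eq_mul, Real.norm_eq_abs, abs_of_pos (half_pos hr)] at this
      have := (abs_le.1 this).2
      linarith
    · have := h2 (y := t - r/2) (by simp [abs_of_pos hr]; linarith)
      rw [show t - r/2 - t = -(r/2) by ring] at this
      simp only [smul_eq_mul, Real.norm_eq_abs, abs_neg, abs_of_pos (half_pos hr)] at this
      have := (abs_le.1 this).2
      linarith
  set θ := min (h * δ / 8) (η / 2) with hθdef
  have hθ : 0 < θ := by rw [hθdef]; positivity
  have hθ1 : θ ≤ h * δ / 8 := min_le_left _ _
  have hθ2 : θ ≤ η / 2 := min_le_right _ _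
  filter_upwards [ev_exp_le (fun n => hpos n t) (hlim t) hθ,
    ev_exp_le (fun n => hpos n (t+h)) (hlim (t+h)) hθ,
    ev_exp_le (fun n => hpos n (t-h)) (hlim (t-h)) hθ,
    ev_exp_small hθ (show (0:ℝ) < 1/2 by norm_num), eventually_gt_atTop 0] with n a1 a2 a3 a4 hn
  have hn' : (0:ℝ) < n := by exact_mod_cast hn
  set B : Set ℝ := {y | |y / n - c| < δ} with hB
  have hBm : MeasurableSet B := by
    apply measurableSet_lt <;> fun_prop
  have hpt : ∀ y : ℝ, Real.exp (t * y) ≤ B.indicator (fun _ => Real.exp (n * (t * c + |t| * δ))) y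
      + (Real.exp (-(h * n * (c + δ))) * Real.exp ((t + h) * y)
      + Real.exp (h * n * (c - δ)) * Real.exp ((t - h) * y)) := by
    intro y
    by_cases hy : y ∈ B
    · rw [indicator_of_mem hy]
      have h1 : t * y ≤ n * (t * c + |t| * δ) := by
        have h2 : |y / n - c| < δ := hy
        have h3 : t * (y / n - c) ≤ |t| * δ :=
          (le_abs_self _).trans (by rw [abs_mul]; gcongr)
        have h4 : t * y = n * (t * (y / n - c)) + n * (t * c) := by field_simp; ring
        rw [h4]
        nlinarith
      have := Real.exp_le_exp.2 h1
      have p1 := Real.exp_pos (-(h * n * (c + δ)))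
      have p2 := Real.exp_pos (h * n * (c - δ))
      have p3 := Real.exp_pos ((t + h) * y)
      have p4 := Real.exp_pos ((t - h) * y)
      have := mul_pos p1 p3
      have := mul_pos p2 p4
      linarith
    · rw [indicator_of_notMem hy, zero_add, ← Real.exp_add, ← Real.exp_add]
      have h2 : ¬ |y / n - c| < δ := hy
      rw [not_lt, le_abs] at h2
      rcases h2 with h2 | h2
      · have h3 : n * (c + δ) ≤ y := by
          have : c + δ ≤ y / n := by linarith
          rw [le_div_iff₀ hn'] at this; linarith
        have h4 : t * y ≤ -(h * n * (c + δ)) + (t + h) * y := by nlinarith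
        have := Real.exp_le_exp.2 h4
        have := Real.exp_pos (h * n * (c - δ) + (t - h) * y)
        linarith
      · have h3 : y ≤ n * (c - δ) := by
          have : y / n ≤ c - δ := by linarith
          rw [div_le_iff₀ hn'] at this; linarith
        have h4 : t * y ≤ (h * n * (c - δ)) + (t - h) * y := by nlinarith
        have := Real.exp_le_exp.2 h4
        have := Real.exp_pos (-(h * n * (c + δ)) + (t + h) * y)
        linarith
  have hI1 : Integrable (B.indicator (fun _ => Real.exp (n * (t * c + |t| * δ)))) (q n) :=
    (integrable_const _).indicator hBm
  have hI2 := (hint n (t+h)).const_mul (Real.exp (-(h * n * (c + δ))))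
  have hI3 := (hint n (t-h)).const_mul (Real.exp (h * n * (c - δ)))
  have hI := integral_mono (hint n t) (hI1.add (hI2.add hI3)) hpt
  simp only [Pi.add_apply] at hI
  have e1 := integral_add hI1 (hI2.add hI3)
  have e2 := integral_add hI2 hI3
  simp only [Pi.add_apply] at e1
  rw [e1, e2, integral_const_mul, integral_const_mul, integral_indicator_const _ hBm, smul_eq_mul] at hI
  set u := Real.exp (-(n * θ)) with hu'
  have hu0 : 0 < u := Real.exp_pos _
  have b1 : Real.exp (-(h * n * (c + δ))) * ∫ y, Real.exp ((t+h) * y) ∂(q n) ≤ Real.exp (n * Λ t) * u^3 := by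
    calc _ ≤ Real.exp (-(h * n * (c + δ))) * Real.exp (n * (Λ (t+h) + θ)) := by gcongr; exact a2.2
      _ ≤ _ := by
        rw [hu', ← Real.exp_nat_mul, ← Real.exp_add, ← Real.exp_add, Real.exp_le_exp]
        push_cast
        have : n * (-(h * (c+δ)) + (Λ (t+h) + θ)) ≤ n * (Λ t - 3 * θ) := by
          gcongr; linarith
        linarith
  have b2 : Real.exp (h * n * (c - δ)) * ∫ y, Real.exp ((t-h) * y) ∂(q n) ≤ Real.exp (n * Λ t) * u^3 := by
    calc _ ≤ Real.exp (h * n * (c - δ)) * Real.exp (n * (Λ (t-h) + θ)) := by gcongr; exact a3.2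
      _ ≤ _ := by
        rw [hu', ← Real.exp_nat_mul, ← Real.exp_add, ← Real.exp_add, Real.exp_le_exp]
        push_cast
        have : n * ((h * (c-δ)) + (Λ (t-h) + θ)) ≤ n * (Λ t - 3 * θ) := by
          gcongr; linarith
        linarith
  have b3 : Real.exp (n * Λ t) * u ≤ ∫ y, Real.exp (t * y) ∂(q n) := by
    refine le_trans (le_of_eq ?_) a1.1
    rw [hu', ← Real.exp_add]; congr 1; ring
  have b4 : Real.exp (n * Λ t) * u^2 ≤ (q n).real B * Real.exp (n * (t * c + |t| * δ)) := by
    have : u^2 ≤ u - 2 * u^3 := by nlinarith [mul_pos hu0 hu0]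
    have := mul_le_mul_of_nonneg_left this (Real.exp_pos (n * Λ t)).le
    linarith
  rw [← div_le_iff₀ (Real.exp_pos _)] at b4
  refine le_trans ?_ b4
  rw [hu', ← Real.exp_nat_mul, ← Real.exp_add, ← Real.exp_sub, Real.exp_le_exp]
  push_cast
  have : n * (Λ t - t * c - |t| * δ - η) ≤ n * (Λ t - 2 * θ - (t * c + |t| * δ)) := by
    gcongr ?_ * ?_; linarith
  linarith

lemma ge_upper {q : ℕ → Measure ℝ} [∀ n, IsFiniteMeasure (q n)]
    (hint : ∀ n s, Integrable (fun y => Real.exp (s * y)) (q n))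
    (hpos : ∀ n s, 0 < ∫ y, Real.exp (s * y) ∂(q n)) {Λ : ℝ → ℝ}
    (hlim : ∀ s, Tendsto (fun n : ℕ => (n:ℝ)⁻¹ * Real.log (∫ y, Real.exp (s * y) ∂(q n))) atTop (𝓝 (Λ s)))
    {A : Set ℝ} {a η : ℝ} (hA : ∀ x ∈ closure A, ∃ t, a < t * x - Λ t) (hη : 0 < η) :
    ∀ᶠ n : ℕ in atTop, (q n) {y | y / n ∈ A} ≤ ENNReal.ofReal (Real.exp (n * (-a + 2 * η))) := by
  obtain ⟨S, hS⟩ : ∃ S : Finset ℝ, A ⊆ ⋃ t ∈ S, {y | a < t * y - Λ t} := by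
    have ho : ∀ t : ℝ, IsOpen {y : ℝ | a < t * y - Λ t} := fun t =>
      isOpen_lt (by fun_prop) (by fun_prop)
    have hK : IsCompact (closure A ∩ Icc (-(a + Λ (-1))) (a + Λ 1)) :=
      isCompact_Icc.inter_left isClosed_closure
    obtain ⟨S, hS⟩ := hK.elim_finite_subcover (fun t : ℝ => {y : ℝ | a < t * y - Λ t}) ho (by
      intro x hx
      obtain ⟨t, ht⟩ := hA x hx.1
      exact mem_iUnion.2 ⟨t, ht⟩)
    refine ⟨insert 1 (insert (-1) S), fun x hx => ?_⟩
    simp only [mem_iUnion, Finset.mem_insert, mem_ofPred_eq, exists_prop]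
    by_cases h1 : x ≤ a + Λ 1
    · by_cases h2 : -(a + Λ (-1)) ≤ x
      · have := hS ⟨subset_closure hx, h2, h1⟩
        simp only [mem_iUnion, mem_ofPred_eq, exists_prop] at this
        obtain ⟨t, ht, h⟩ := this
        exact ⟨t, Or.inr (Or.inr ht), h⟩
      · exact ⟨-1, by simp, by linarith⟩
    · exact ⟨1, by simp, by linarith⟩
  have hev : ∀ᶠ n : ℕ in atTop, ∀ t ∈ S, ∫ y, Real.exp (t * y) ∂(q n) ≤ Real.exp (n * (Λ t + η)) := by
    rw [Filter.eventually_all_finset]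
    intro t _
    exact (ev_exp_le (fun n => hpos n t) (hlim t) hη).mono fun n h => h.2
  filter_upwards [hev, ev_exp_small hη (show (0:ℝ) < 1 / (S.card + 1) by positivity),
    eventually_gt_atTop 0] with n h1 h2 hn
  have hn' : (0:ℝ) < n := by exact_mod_cast hn
  have hsub : {y : ℝ | y / n ∈ A} ⊆ ⋃ t ∈ S, {y | n * (a + Λ t) ≤ t * y} := by
    intro y hy
    have := hS hy
    simp only [mem_iUnion, mem_ofPred_eq, exists_prop] at this ⊢
    obtain ⟨t, ht, h⟩ := this
    refine ⟨t, ht, ?_⟩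
    have h3 : t * y = n * (t * (y / n)) := by field_simp
    rw [h3]
    gcongr
    linarith
  have hch : ∀ t ∈ S, (q n) {y | n * (a + Λ t) ≤ t * y} ≤ ENNReal.ofReal (Real.exp (n * (-a + η))) := by
    intro t ht
    rw [← ofReal_measureReal]
    apply ENNReal.ofReal_le_ofReal
    have := ProbabilityTheory.measure_ge_le_exp_mul_mgf (μ := q n) (X := fun y => t * y) (t := 1)
      (n * (a + Λ t)) zero_le_one (by simpa using hint n t)
    simp only [ProbabilityTheory.mgf, one_mul] at this
    refine this.trans ?_
    calc _ ≤ Real.exp (-1 * (n * (a + Λ t))) * Real.exp (n * (Λ t + η)) := by gcongr; exact h1 t ht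
      _ = _ := by rw [← Real.exp_add]; congr 1; ring
  calc (q n) {y | y / n ∈ A} ≤ (q n) (⋃ t ∈ S, {y | n * (a + Λ t) ≤ t * y}) := measure_mono hsub
    _ ≤ ∑ t ∈ S, (q n) {y | n * (a + Λ t) ≤ t * y} := measure_biUnion_finset_le _ _
    _ ≤ ∑ t ∈ S, ENNReal.ofReal (Real.exp (n * (-a + η))) := Finset.sum_le_sum hch
    _ = ENNReal.ofReal (S.card * Real.exp (n * (-a + η))) := by
        rw [Finset.sum_const, nsmul_eq_mul, ENNReal.ofReal_mul (by positivity), ENNReal.ofReal_natCast]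
    _ ≤ _ := by
        apply ENNReal.ofReal_le_ofReal
        have h3 : (S.card : ℝ) ≤ Real.exp (n * η) := by
          rw [Real.exp_neg, inv_eq_one_div, one_div_le_one_div (Real.exp_pos _) (by positivity)] at h2
          linarith
        calc _ ≤ Real.exp (n * η) * Real.exp (n * (-a + η)) := by gcongr
          _ = _ := by rw [← Real.exp_add]; congr 1; ring

lemma ge_main {q : ℕ → Measure ℝ} [∀ n, IsFiniteMeasure (q n)]
    (hint : ∀ n s, Integrable (fun y => Real.exp (s * y)) (q n))
    (hpos : ∀ n s, 0 < ∫ y, Real.exp (s * y) ∂(q n)) {Λ Λ' : ℝ → ℝ}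
    (hlim : ∀ s, Tendsto (fun n : ℕ => (n:ℝ)⁻¹ * Real.log (∫ y, Real.exp (s * y) ∂(q n))) atTop (𝓝 (Λ s)))
    (hd : ∀ t, HasDerivAt Λ (Λ' t) t)
    (Λstar : ℝ → EReal)
    (hΛstar : ∀ x, Λstar x = ⨆ t : ℝ, ((t * x - Λ t : ℝ) : EReal)) (A : Set ℝ) :
      (-(⨅ x ∈ interior A, Λstar x) ≤
          Filter.liminf (fun n : ℕ =>
            (((n : ℝ)⁻¹ : ℝ) : EReal) * ENNReal.log (q n {y : ℝ | y / n ∈ A})) atTop) ∧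
      (Filter.limsup (fun n : ℕ =>
            (((n : ℝ)⁻¹ : ℝ) : EReal) * ENNReal.log (q n {y : ℝ | y / n ∈ A})) atTop ≤
          -(⨅ x ∈ closure A, Λstar x)) := by
  constructor
  · rw [EReal.neg_le]
    refine le_iInf₂ fun x hx => ?_
    rw [EReal.neg_le]
    refine EReal.ge_of_forall_gt_iff_ge.1 fun z hz => ?_
    rw [EReal.lt_neg_comm] at hz
    obtain ⟨V, hV1, hV2⟩ := EReal.lt_iff_exists_real_btwn.1 hz
    have hV2 : V < -z := by exact_mod_cast hV2
    have hV : ∀ t, t * x - Λ t ≤ V := by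
      intro t
      have : ((t * x - Λ t : ℝ) : EReal) ≤ V := by
        refine le_trans ?_ hV1.le
        rw [hΛstar]
        exact le_iSup (fun t : ℝ => ((t * x - Λ t : ℝ) : EReal)) t
      exact_mod_cast this
    obtain ⟨r, hr, hrA⟩ := Metric.isOpen_iff.1 isOpen_interior x hx
    obtain ⟨t, ht1, ht2⟩ := exists_exposed hd hV (half_pos hr)
    set η := (-z - V) / 2 with hη
    have hη0 : 0 < η := by rw [hη]; linarith
    set δ := min (r/2) (η / (|t| + 1)) with hδ
    have hδ0 : 0 < δ := by rw [hδ]; positivity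
    have hδ1 : |t| * δ ≤ η := by
      have h1 : δ ≤ η / (|t| + 1) := min_le_right _ _
      rw [le_div_iff₀ (by positivity)] at h1
      nlinarith
    apply le_liminf_of_le
    · exact isCobounded_ge_of_top
    filter_upwards [ge_lower hint hpos hlim (hd t) hδ0 hη0, eventually_gt_atTop 0] with n h1 hn
    apply ereal_ge_aux hn
    calc ENNReal.ofReal (Real.exp (n * z)) ≤ ENNReal.ofReal ((q n).real {y | |y / n - Λ' t| < δ}) := by
          apply ENNReal.ofReal_le_ofReal
          refine le_trans ?_ h1
          rw [Real.exp_le_exp]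
          gcongr
          linarith
      _ = (q n) {y | |y / n - Λ' t| < δ} := ofReal_measureReal
      _ ≤ _ := by
          apply measure_mono
          intro y hy
          have hy : |y / n - Λ' t| < δ := hy
          apply interior_subset (hrA _)
          rw [Metric.mem_ball, Real.dist_eq]
          have h2 : δ ≤ r / 2 := min_le_left _ _
          have := abs_sub_le (y / n) (Λ' t) x
          linarith
  · refine EReal.le_of_forall_lt_iff_le.1 fun z hz => ?_
    rw [EReal.neg_lt_comm] at hz
    obtain ⟨a, ha1, ha2⟩ := EReal.lt_iff_exists_real_btwn.1 hz
    have ha1 : -z < a := by exact_mod_cast ha1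
    have hA : ∀ x ∈ closure A, ∃ t, a < t * x - Λ t := by
      intro x hx
      have : (a : EReal) < Λstar x := ha2.trans_le (iInf₂_le x hx)
      rw [hΛstar, lt_iSup_iff] at this
      obtain ⟨t, ht⟩ := this
      exact ⟨t, by exact_mod_cast ht⟩
    apply limsup_le_of_le
    · exact isCobounded_le_of_bot
    filter_upwards [ge_upper hint hpos hlim hA (show 0 < (a + z) / 2 by linarith),
      eventually_gt_atTop 0] with n h1 hn
    apply ereal_le_aux hn
    convert h1 using 4
    ring

lemma conv_ext {F : ℕ → ℝ → ℝ} (hF : ∀ n, ConvexOn ℝ univ (F n)) {Λ : ℝ → ℝ} (hc : Continuous Λ)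
    (hq : ∀ s : ℚ, Tendsto (fun n => F n s) atTop (𝓝 (Λ s))) (s : ℝ) :
    Tendsto (fun n => F n s) atTop (𝓝 (Λ s)) := by
  have hup : ∀ s : ℝ, ∀ ε > 0, ∀ᶠ n in atTop, F n s < Λ s + ε := by
    intro s ε hε
    obtain ⟨r, hr, h⟩ := Metric.continuous_iff.1 hc s ε hε
    obtain ⟨a, ha1, ha2⟩ := exists_rat_btwn (show s - r < s by linarith)
    obtain ⟨b, hb1, hb2⟩ := exists_rat_btwn (show s < s + r by linarith)
    have h1 := h a (by rw [Real.dist_eq, abs_lt]; constructor <;> linarith)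
    have h2 := h b (by rw [Real.dist_eq, abs_lt]; constructor <;> linarith)
    rw [Real.dist_eq, abs_lt] at h1 h2
    filter_upwards [(hq a).eventually_lt_const (show Λ a < Λ s + ε by linarith),
      (hq b).eventually_lt_const (show Λ b < Λ s + ε by linarith)] with n h3 h4
    refine lt_of_le_of_lt ((hF n).le_max_of_mem_Icc (mem_univ _) (mem_univ _) ⟨ha2.le, hb1.le⟩) ?_
    exact max_lt h3 h4
  rw [Metric.tendsto_nhds]
  intro ε hε
  have hε3 : 0 < ε / 8 := by positivity
  obtain ⟨r, hr, h⟩ := Metric.continuous_iff.1 hc s (ε / 8) hε3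
  obtain ⟨a, ha1, ha2⟩ := exists_rat_btwn (show s < s + r / 2 by linarith)
  have h1 := h a (by rw [Real.dist_eq, abs_lt]; constructor <;> linarith)
  have h2 := h (2 * a - s) (by rw [Real.dist_eq, abs_lt]; constructor <;> linarith)
  rw [Real.dist_eq, abs_lt] at h1 h2
  filter_upwards [hup s ε hε, hup (2 * a - s) _ hε3,
    (hq a).eventually_const_lt (show Λ a - ε / 8 < Λ a by linarith)] with n h3 h4 h5
  have h6 := (hF n).2 (mem_univ s) (mem_univ (2 * (a:ℝ) - s)) (show (0:ℝ) ≤ 1/2 by norm_num)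
    (show (0:ℝ) ≤ 1/2 by norm_num) (by norm_num)
  simp only [smul_eq_mul] at h6
  rw [show 1 / 2 * s + 1 / 2 * (2 * (a:ℝ) - s) = a by ring] at h6
  rw [Real.dist_eq, abs_lt]
  constructor <;> linarith

lemma int_all {ν : Measure ℝ} (h : ∀ k : ℤ, Integrable (fun x => Real.exp ((k:ℝ) * x)) ν) (t : ℝ) :
    Integrable (fun x => Real.exp (t * x)) ν :=
  ProbabilityTheory.integrable_exp_mul_of_le_of_le (X := fun x : ℝ => x)
    (h ⌊t⌋) (h ⌈t⌉) (Int.floor_le t) (Int.le_ceil t)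

section cg
open ProbabilityTheory

lemma cg_mem {ν : Measure ℝ} (h : ∀ t : ℝ, Integrable (fun x => Real.exp (t * x)) ν) (t : ℝ) :
    t ∈ interior (integrableExpSet (fun x : ℝ => x) ν) := by
  have : integrableExpSet (fun x : ℝ => x) ν = univ := by
    ext t; simpa [integrableExpSet] using h t
  rw [this]; simp

lemma cg_diff {ν : Measure ℝ} (h : ∀ t : ℝ, Integrable (fun x => Real.exp (t * x)) ν) :
    Differentiable ℝ (cgf (fun x : ℝ => x) ν) :=
  fun t => (analyticAt_cgf (cg_mem h t)).differentiableAt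

lemma cg_conv {ν : Measure ℝ} (h : ∀ t : ℝ, Integrable (fun x => Real.exp (t * x)) ν) :
    ConvexOn ℝ univ (cgf (fun x : ℝ => x) ν) := by
  apply convexOn_univ_of_deriv2_nonneg (cg_diff h)
  · exact fun t => (analyticAt_cgf (cg_mem h t)).deriv.differentiableAt
  · intro t
    have := iteratedDeriv_two_cgf_eq_integral (cg_mem h t)
    rw [iteratedDeriv_eq_iterate] at this
    rw [this]
    apply div_nonneg _ mgf_nonneg
    apply integral_nonneg
    intro x
    positivity

end cg

theorem quenched_mean_LDP
    {E : Type*} [MeasurableSpace E] (μ : Measure E) [IsProbabilityMeasure μ]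
    (T : E → E) (hT : Ergodic T μ)
    (κ : E → Measure ℝ) (hκmeas : Measurable κ)
    [hκfin : ∀ ω, IsFiniteMeasure (κ ω)] (hκne : ∀ ω, κ ω ≠ 0)
    (m : ℝ → E → ℝ)
    (hm : ∀ t ω, m t ω = ∫ x, Real.exp (t * x) ∂(κ ω))
    (hpos : ∀ t : ℝ, ∀ᵐ ω ∂μ,
      0 < m t ω ∧ Integrable (fun x => Real.exp (t * x)) (κ ω) ∧
        Integrable (fun x => |x| * Real.exp (t * x)) (κ ω))
    (hlog : ∀ t : ℝ, Integrable (fun ω => Real.log (m t ω)) μ)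
    (hder : ∀ t : ℝ,
      Integrable (fun ω => (∫ x, x * Real.exp (t * x) ∂(κ ω)) / m t ω) μ)
    (Λ : ℝ → ℝ) (hΛ : ∀ t, Λ t = ∫ ω, Real.log (m t ω) ∂μ)
    (Λstar : ℝ → EReal)
    (hΛstar : ∀ x, Λstar x = ⨆ t : ℝ, ((t * x - Λ t : ℝ) : EReal)) :
    ∀ᵐ ω ∂μ, ∀ A : Set ℝ, MeasurableSet A →
      (-(⨅ x ∈ interior A, Λstar x) ≤
          Filter.liminf (fun n : ℕ =>
            (((n : ℝ)⁻¹ : ℝ) : EReal) * ENNReal.log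
              ((Measure.map (fun f : Fin n → ℝ => ∑ i, f i)
                  (Measure.pi fun i : Fin n => κ (T^[(i : ℕ)] ω)))
                {y : ℝ | y / n ∈ A})) atTop) ∧
      (Filter.limsup (fun n : ℕ =>
            (((n : ℝ)⁻¹ : ℝ) : EReal) * ENNReal.log
              ((Measure.map (fun f : Fin n → ℝ => ∑ i, f i)
                  (Measure.pi fun i : Fin n => κ (T^[(i : ℕ)] ω)))
                {y : ℝ | y / n ∈ A})) atTop ≤
          -(⨅ x ∈ closure A, Λstar x)) := by
  have hcg : ∀ t ω, Real.log (m t ω) = ProbabilityTheory.cgf (fun x : ℝ => x) (κ ω) t := by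
    intro t ω
    rw [hm, ProbabilityTheory.cgf, ProbabilityTheory.mgf]
  have hall : ∀ᵐ ω ∂μ, ∀ t : ℝ, Integrable (fun x => Real.exp (t * x)) (κ ω) := by
    have : ∀ᵐ ω ∂μ, ∀ k : ℤ, Integrable (fun x => Real.exp ((k:ℝ) * x)) (κ ω) :=
      ae_all_iff.2 fun k => (hpos k).mono fun ω h => h.2.1
    exact this.mono fun ω h => int_all h
  have hallT : ∀ᵐ ω ∂μ, ∀ (i : ℕ) (t : ℝ), Integrable (fun x => Real.exp (t * x)) (κ (T^[i] ω)) :=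
    ae_all_iff.2 fun i => (hT.toMeasurePreserving.quasiMeasurePreserving.iterate i).ae hall
  -- derivative of Λ
  have hdc : ∀ t ω, (∀ t : ℝ, Integrable (fun x => Real.exp (t * x)) (κ ω)) →
      deriv (ProbabilityTheory.cgf (fun x : ℝ => x) (κ ω)) t =
      (∫ x, x * Real.exp (t * x) ∂(κ ω)) / m t ω := by
    intro t ω h
    rw [ProbabilityTheory.deriv_cgf (cg_mem h t), hm, ProbabilityTheory.mgf]
  have hd : ∀ t, HasDerivAt Λ (∫ ω, (∫ x, x * Real.exp (t * x) ∂(κ ω)) / m t ω ∂μ) t := by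
    intro t
    have hΛ' : Λ = fun t => ∫ ω, Real.log (m t ω) ∂μ := funext hΛ
    rw [hΛ']
    refine (hasDerivAt_integral_of_dominated_loc_of_deriv_le
      (F := fun t ω => Real.log (m t ω))
      (F' := fun t ω => (∫ x, x * Real.exp (t * x) ∂(κ ω)) / m t ω)
      (bound := fun ω => |(∫ x, x * Real.exp ((t-1) * x) ∂(κ ω)) / m (t-1) ω| +
        |(∫ x, x * Real.exp ((t+1) * x) ∂(κ ω)) / m (t+1) ω|)
      (Metric.ball_mem_nhds t one_pos) ?_ (hlog t) (hder t).1 ?_ ?_ ?_).2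
    · exact Eventually.of_forall fun s => (hlog s).1
    · filter_upwards [hall] with ω h s hs
      rw [Metric.mem_ball, Real.dist_eq, abs_lt] at hs
      rw [← hdc _ _ h, ← hdc _ _ h, ← hdc _ _ h]
      have hmono : Monotone (deriv (ProbabilityTheory.cgf (fun x : ℝ => x) (κ ω))) := by
        have := (cg_conv h).monotoneOn_deriv (fun x _ => cg_diff h x)
        exact monotoneOn_univ.1 this
      have h1 := hmono (show t - 1 ≤ s by linarith)
      have h2 := hmono (show s ≤ t + 1 by linarith)
      rw [Real.norm_eq_abs, abs_le]
      constructor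
      · have := neg_abs_le (deriv (ProbabilityTheory.cgf (fun x : ℝ => x) (κ ω)) (t-1))
        have := abs_nonneg (deriv (ProbabilityTheory.cgf (fun x : ℝ => x) (κ ω)) (t+1))
        linarith
      · have := le_abs_self (deriv (ProbabilityTheory.cgf (fun x : ℝ => x) (κ ω)) (t+1))
        have := abs_nonneg (deriv (ProbabilityTheory.cgf (fun x : ℝ => x) (κ ω)) (t-1))
        linarith
    · exact (hder (t-1)).abs.add (hder (t+1)).abs
    · filter_upwards [hall] with ω h s hs
      rw [← hdc _ _ h]
      have : (fun s => Real.log (m s ω)) = ProbabilityTheory.cgf (fun x : ℝ => x) (κ ω) :=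
        funext fun s => hcg s ω
      rw [this]
      exact (cg_diff h s).hasDerivAt
  have hΛc : Continuous Λ := continuous_iff_continuousAt.2 fun t => (hd t).continuousAt
  have hmeas : ∀ t, Measurable fun ω => Real.log (m t ω) := by
    intro t
    apply Real.measurable_log.comp
    change Measurable fun ω => m t ω
    have hfun : (fun ω => m t ω) = fun ω => (∫⁻ x, ENNReal.ofReal (Real.exp (t * x)) ∂(κ ω)).toReal := by
      funext ω
      rw [hm, integral_eq_lintegral_of_nonneg_ae (ae_of_all _ fun x => (Real.exp_pos _).le)
        (by fun_prop)]
    rw [hfun]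
    exact ((Measure.measurable_lintegral (by fun_prop)).comp hκmeas).ennreal_toReal
  have hbk : ∀ᵐ ω ∂μ, ∀ s : ℚ, Tendsto (fun n : ℕ => (n:ℝ)⁻¹ *
      birkhoffSum T (fun ω => Real.log (m s ω)) n ω) atTop (𝓝 (Λ s)) := by
    refine ae_all_iff.2 fun s => ?_
    rw [hΛ]
    exact birkhoff_tendsto hT (hlog s) (hmeas s)
  filter_upwards [hallT, hbk] with ω hω hb A _
  have hprodI : ∀ (n : ℕ) (s : ℝ), Integrable (fun f : Fin n → ℝ => Real.exp (s * ∑ i, f i))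
      (Measure.pi fun i : Fin n => κ (T^[(i : ℕ)] ω)) := by
    intro n s
    have := Integrable.fintype_prod (f := fun (i : Fin n) (x : ℝ) => Real.exp (s * x))
      (μ := fun i : Fin n => κ (T^[(i : ℕ)] ω)) (fun i => hω i s)
    refine this.congr (ae_of_all _ fun f => ?_)
    simp only
    rw [Finset.mul_sum, Real.exp_sum]
  have hsm : ∀ n : ℕ, Measurable (fun f : Fin n → ℝ => ∑ i, f i) := fun n => by fun_prop
  have hprod : ∀ (n : ℕ) (s : ℝ), ∫ y, Real.exp (s * y) ∂(Measure.map (fun f : Fin n → ℝ => ∑ i, f i)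
      (Measure.pi fun i : Fin n => κ (T^[(i : ℕ)] ω))) = ∏ i : Fin n, m s (T^[(i:ℕ)] ω) := by
    intro n s
    rw [integral_map (hsm n).aemeasurable (by fun_prop)]
    have := integral_fintype_prod_eq_prod (𝕜 := ℝ) (fun (i : Fin n) (x : ℝ) => Real.exp (s * x))
      (μ := fun i : Fin n => κ (T^[(i : ℕ)] ω))
    simp only [hm, ← this]
    congr 1
    funext f
    rw [Finset.mul_sum, Real.exp_sum]
  have hmpos : ∀ i s, 0 < m s (T^[i] ω) := by
    intro i s
    rw [hm]
    exact ProbabilityTheory.mgf_pos' (X := fun x : ℝ => x) (hκne _) (hω i s)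
  refine ge_main (q := fun n => Measure.map (fun f : Fin n → ℝ => ∑ i, f i)
      (Measure.pi fun i : Fin n => κ (T^[(i : ℕ)] ω))) ?_ ?_ ?_ hd Λstar hΛstar A
  · intro n s
    rw [integrable_map_measure (by fun_prop) (hsm n).aemeasurable]
    exact hprodI n s
  · intro n s
    rw [hprod]
    exact Finset.prod_pos fun i _ => hmpos i s
  · intro s
    have hlg : ∀ (n : ℕ) (s : ℝ), Real.log (∫ y, Real.exp (s * y) ∂(Measure.map (fun f : Fin n → ℝ => ∑ i, f i)
      (Measure.pi fun i : Fin n => κ (T^[(i : ℕ)] ω)))) =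
        birkhoffSum T (fun ω => Real.log (m s ω)) n ω := by
      intro n s
      rw [hprod, Real.log_prod (fun (i : Fin n) _ => (hmpos (i:ℕ) s).ne'), birkhoffSum,
        ← Fin.sum_univ_eq_sum_range (fun i => Real.log (m s (T^[i] ω)))]
    simp only [hlg]
    refine conv_ext (F := fun n s => (n:ℝ)⁻¹ * birkhoffSum T (fun ω => Real.log (m s ω)) n ω)
      ?_ hΛc hb s
    intro n
    have hs : ConvexOn ℝ univ (fun s => birkhoffSum T (fun ω => Real.log (m s ω)) n ω) := by
      induction n with
      | zero => simpa using convexOn_const (0:ℝ) convex_univ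
      | succ n ih =>
        simp only [birkhoffSum_succ]
        refine ih.add ?_
        simp only [hcg]
        exact cg_conv (hω n)
    exact hs.smul (by positivity : (0:ℝ) ≤ (n:ℝ)⁻¹)
end

section
/- Let (E, μ) be a probability space, T : E → E an ergodic measure-preserving transformation, and ω ↦ ν(ω) a measurable kernel assigning to each ω ∈ E a Borel probability measure on ℝ. Assume that for μ-a.e. ω, ∫ |x| ν(ω)(dx) < ∞; let μ̄(ω) = ∫ x ν(ω)(dx) and σ²(ω) = ∫ (x − μ̄(ω))² ν(ω)(dx), and assume 0 < ∫_E σ²(ω) μ(dω) < ∞. For ω ∈ E set μ_i = μ̄(T^iω), σ_i² = σ²(T^iω) and b_n = (Σ_{i=0}^{n−1} σ_i²)^{1/2}. Then the triangular array {ν(T^iω)} satisfies the Lindeberg condition almost surely: for μ-a.e. ω and every t > 0, (1/b_n²) Σ_{i=0}^{n−1} ∫_{{x : |x−μ_i| > t b_n}} |x − μ_i|² ν(T^iω)(dx) → 0 as n → ∞. -/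
open MeasureTheory Filter Topology Set
open scoped ENNReal NNReal

/-- truncated maximal function, recursively -/
noncomputable def maxAux {E : Type*} (T : E → E) (g : E → ℝ) : ℕ → E → ℝ
  | 0 => fun _ => 0
  | n + 1 => fun x => max 0 (g x + maxAux T g n (T x))

lemma maxAux_nonneg {E : Type*} (T : E → E) (g : E → ℝ) (n : ℕ) (x : E) :
    0 ≤ maxAux T g n x := by
  cases n <;> simp [maxAux]

lemma maxAux_le_succ {E : Type*} (T : E → E) (g : E → ℝ) (n : ℕ) (x : E) :
    maxAux T g n x ≤ maxAux T g (n + 1) x := by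
  induction n generalizing x with
  | zero => simp [maxAux]
  | succ n ih =>
    change max 0 (g x + maxAux T g n (T x)) ≤ max 0 (g x + maxAux T g (n+1) (T x))
    have := ih (T x)
    gcongr

lemma sum_le_maxAux {E : Type*} (T : E → E) (g : E → ℝ) (n : ℕ) (x : E) :
    ∑ i ∈ Finset.range n, g (T^[i] x) ≤ maxAux T g n x := by
  induction n generalizing x with
  | zero => simp [maxAux]
  | succ n ih =>
    rw [Finset.sum_range_succ']
    have := ih (T x)
    simp only [Function.iterate_succ, Function.comp, Function.iterate_zero, id] at this ⊢
    refine le_trans ?_ (le_max_right _ _)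
    linarith

lemma maxAux_meas {E : Type*} [MeasurableSpace E] (T : E → E) (hT : Measurable T)
    (g : E → ℝ) (hg : Measurable g) (n : ℕ) : Measurable (maxAux T g n) := by
  induction n with
  | zero => exact measurable_const
  | succ n ih => exact measurable_const.max (hg.add (ih.comp hT))

lemma maxAux_int {E : Type*} [MeasurableSpace E] {μ : Measure E} [IsProbabilityMeasure μ]
    (T : E → E) (hT : MeasurePreserving T μ μ)
    (g : E → ℝ) (hg : Integrable g μ) (n : ℕ) : Integrable (maxAux T g n) μ := by
  induction n with
  | zero => exact integrable_const 0
  | succ n ih => exact (integrable_const (0:ℝ)).sup (hg.add (hT.integrable_comp_of_integrable ih))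

lemma ergodic_bdd {E : Type*} [MeasurableSpace E] {μ : Measure E} [IsProbabilityMeasure μ]
    (T : E → E) (hT : Ergodic T μ) (g : E → ℝ) (hgm : Measurable g) (hg : Integrable g μ)
    (hneg : ∫ x, g x ∂μ < 0) :
    ∀ᵐ x ∂μ, ∃ C : ℝ, ∀ n : ℕ, ∑ i ∈ Finset.range n, g (T^[i] x) ≤ C := by
  have hTm := hT.toMeasurePreserving
  set M := maxAux T g with hM
  have hmono : ∀ x, Monotone (fun n => M n x) := fun x =>
    monotone_nat_of_le_succ (fun n => maxAux_le_succ T g n x)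
  let A : Set E := {x | BddAbove (range fun n => M n x)}
  have hA : MeasurableSet A :=
    measurableSet_bddAbove_range (fun n => maxAux_meas T hTm.measurable g hgm n)
  have hinv : T ⁻¹' A = A := by
    ext x
    constructor
    · rintro ⟨C, hC⟩
      refine ⟨max 0 (g x + C), ?_⟩
      rintro _ ⟨n, rfl⟩
      cases n with
      | zero => exact le_max_left _ _
      | succ n =>
        have : M n (T x) ≤ C := hC ⟨n, rfl⟩
        change max 0 (g x + M n (T x)) ≤ _
        gcongr
    · rintro ⟨C, hC⟩
      refine ⟨C - g x, ?_⟩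
      rintro _ ⟨n, rfl⟩
      have h1 : max 0 (g x + M n (T x)) ≤ C := hC ⟨n+1, rfl⟩
      have := (le_max_right _ _).trans h1
      change M n (T x) ≤ _
      linarith
  have key : A =ᵐ[μ] univ := by
    rcases hT.toPreErgodic.ae_empty_or_univ hA hinv with h | h
    · exfalso
      have hTA : ∀ᵐ x ∂μ, ¬ T x ∈ A := by
        have : ∀ᵐ x ∂μ, ¬ x ∈ A := by
          filter_upwards [h] with x hx
          intro hxA
          have : (A x) = (∅ : Set E) x := hx
          exact (this ▸ hxA : (∅ : Set E) x)
        exact hTm.quasiMeasurePreserving.ae this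
      have hlim : Tendsto (fun n => ∫ x, max (-(M n (T x))) (g x) ∂μ) atTop
          (𝓝 (∫ x, g x ∂μ)) := by
        refine tendsto_integral_of_dominated_convergence (fun x => |g x|) ?_ hg.abs ?_ ?_
        · intro n
          exact (((maxAux_meas T hTm.measurable g hgm n).comp hTm.measurable).neg.max
            hgm).aestronglyMeasurable
        · intro n
          refine Eventually.of_forall fun x => ?_
          have := maxAux_nonneg T g n (T x)
          change 0 ≤ M n (T x) at this
          rw [Real.norm_eq_abs]
          rcases le_total (-(M n (T x))) (g x) with h | h
          · rw [max_eq_right h]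
          · rw [max_eq_left h, abs_of_nonpos (by linarith), abs_of_nonpos (by linarith)]
            linarith
        · filter_upwards [hTA] with x hx
          have ht : Tendsto (fun n => M n (T x)) atTop atTop :=
            tendsto_atTop_atTop_of_monotone' (hmono _) hx
          refine tendsto_const_nhds.congr' ?_
          filter_upwards [ht.eventually_ge_atTop (-(g x))] with n hn
          rw [max_eq_right (by linarith)]
      have hnn : ∀ n, 0 ≤ ∫ x, max (-(M n (T x))) (g x) ∂μ := by
        intro n
        have hi := maxAux_int T hTm g hg
        have e : ∀ x, max (-(M n (T x))) (g x) = M (n+1) x - M n (T x) := by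
          intro x
          change _ = max 0 (g x + M n (T x)) - M n (T x)
          rw [← max_sub_sub_right, zero_sub, add_sub_cancel_right]
        have hc : ∫ x, M n (T x) ∂μ = ∫ x, M n x ∂μ := by
          have := integral_map (μ := μ) hTm.measurable.aemeasurable (f := M n)
            (maxAux_meas T hTm.measurable g hgm n).aestronglyMeasurable
          rw [hTm.map_eq] at this
          exact this.symm
        simp_rw [e]
        have hs : ∫ x, (M (n+1) x - M n (T x)) ∂μ = ∫ x, M (n+1) x ∂μ - ∫ x, M n (T x) ∂μ :=
          integral_sub (hi (n+1)) (hTm.integrable_comp_of_integrable (hi n))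
        rw [hs, hc, sub_nonneg]
        exact integral_mono (hi n) (hi (n+1)) (fun x => maxAux_le_succ T g n x)
      have := ge_of_tendsto' hlim hnn
      linarith
    · exact h
  filter_upwards [eventuallyEq_univ.1 key] with x hx
  obtain ⟨C, hC⟩ := hx
  exact ⟨C, fun n => (sum_le_maxAux T g n x).trans (hC ⟨n, rfl⟩)⟩

/-- **Almost sure Lindeberg condition** for the normalized intensity measures of a
branching random walk in a stationary ergodic random environment (key step in the proof
of Theorem 9.1). -/
theorem lindeberg_condition_ae
    {E : Type*} [MeasurableSpace E] (μ : Measure E) [IsProbabilityMeasure μ]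
    (T : E → E) (hT : Ergodic T μ)
    (ν : E → Measure ℝ) (hνmeas : Measurable ν)
    [hνprob : ∀ ω, IsProbabilityMeasure (ν ω)]
    (hL1 : ∀ᵐ ω ∂μ, Integrable (fun x => |x|) (ν ω))
    (μbar : E → ℝ) (hμbar : ∀ ω, μbar ω = ∫ x, x ∂(ν ω))
    (σ2 : E → ℝ≥0∞)
    (hσ2 : ∀ ω, σ2 ω = ∫⁻ x, ENNReal.ofReal ((x - μbar ω) ^ 2) ∂(ν ω))
    (hσ2pos : 0 < ∫⁻ ω, σ2 ω ∂μ) (hσ2fin : (∫⁻ ω, σ2 ω ∂μ) < ⊤)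
    (b : ℕ → E → ℝ)
    (hb : ∀ n ω, b n ω = Real.sqrt (∑ i ∈ Finset.range n, (σ2 (T^[i] ω)).toReal)) :
    ∀ᵐ ω ∂μ, ∀ t : ℝ, 0 < t →
      Tendsto (fun n : ℕ =>
          (1 / (b n ω) ^ 2) * ∑ i ∈ Finset.range n,
            (∫⁻ x in {x : ℝ | t * b n ω < |x - μbar (T^[i] ω)|},
                ENNReal.ofReal ((x - μbar (T^[i] ω)) ^ 2) ∂(ν (T^[i] ω))).toReal)
        atTop (nhds 0) := by
  have hTm := hT.toMeasurePreserving
  let κ : ProbabilityTheory.Kernel E ℝ := ⟨ν, hνmeas⟩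
  haveI : ProbabilityTheory.IsMarkovKernel κ := ⟨hνprob⟩
  have hκ : ∀ ω, κ ω = ν ω := fun _ => rfl
  have hμm : Measurable μbar := by
    have : μbar = fun ω => ∫ x, x ∂(κ ω) := funext hμbar
    rw [this]
    exact (StronglyMeasurable.integral_kernel (κ := κ) (f := fun x : ℝ => x)
      stronglyMeasurable_id).measurable
  have hsq : Measurable (fun p : E × ℝ => ENNReal.ofReal ((p.2 - μbar p.1) ^ 2)) := by
    fun_prop
  have hset : ∀ (K : ℝ) (ω : E), MeasurableSet {x : ℝ | K < |x - μbar ω|} := by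
    intro K ω
    exact measurableSet_lt measurable_const (by fun_prop)
  let h : ℕ → E → ℝ≥0∞ := fun K ω => ∫⁻ x in {x : ℝ | (K:ℝ) < |x - μbar ω|},
    ENNReal.ofReal ((x - μbar ω) ^ 2) ∂(ν ω)
  have hσm : Measurable σ2 := by
    have : σ2 = fun ω => ∫⁻ x, ENNReal.ofReal ((x - μbar ω) ^ 2) ∂(κ ω) := funext hσ2
    rw [this]
    exact Measurable.lintegral_kernel_prod_right' (κ := κ) hsq
  have hhi : ∀ K ω, h K ω = ∫⁻ x, {x : ℝ | (K:ℝ) < |x - μbar ω|}.indicator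
      (fun x => ENNReal.ofReal ((x - μbar ω) ^ 2)) x ∂(ν ω) := fun K ω =>
    (lintegral_indicator (hset K ω) _).symm
  have hhm : ∀ K, Measurable (h K) := by
    intro K
    have hS : MeasurableSet {p : E × ℝ | (K:ℝ) < |p.2 - μbar p.1|} :=
      measurableSet_lt measurable_const (by fun_prop)
    have := Measurable.lintegral_kernel_prod_right' (κ := κ) (hsq.indicator hS)
    have e : h K = fun ω => ∫⁻ x, {p : E × ℝ | (K:ℝ) < |p.2 - μbar p.1|}.indicator
        (fun p : E × ℝ => ENNReal.ofReal ((p.2 - μbar p.1) ^ 2)) (ω, x) ∂(κ ω) := by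
      ext ω
      rw [hhi]
      rfl
    rw [e]
    exact this
  have hle : ∀ K ω, h K ω ≤ σ2 ω := by
    intro K ω
    rw [hσ2]
    exact setLIntegral_le_lintegral _ _
  have hσfin : ∀ᵐ ω ∂μ, σ2 ω < ⊤ := ae_lt_top hσm hσ2fin.ne
  have hh0 : ∀ᵐ ω ∂μ, Tendsto (fun K => h K ω) atTop (𝓝 0) := by
    filter_upwards [hσfin] with ω hω
    simp_rw [hhi]
    rw [← lintegral_zero (μ := ν ω)]
    refine tendsto_lintegral_of_dominated_convergence
      (fun x => ENNReal.ofReal ((x - μbar ω) ^ 2)) ?_ ?_ ?_ ?_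
    · intro K
      exact Measurable.indicator (by fun_prop) (hset K ω)
    · intro K
      exact Eventually.of_forall fun x => indicator_le_self _ _ x
    · rw [← hσ2]; exact hω.ne
    · refine Eventually.of_forall fun x => ?_
      refine tendsto_const_nhds.congr' ?_
      obtain ⟨N, hN⟩ := exists_nat_ge |x - μbar ω|
      filter_upwards [eventually_ge_atTop N] with K hK
      rw [indicator_of_notMem]
      simp only [mem_ofPred_eq, not_lt]
      exact hN.trans (by exact_mod_cast hK)
  have hint0 : Tendsto (fun K => ∫⁻ ω, h K ω ∂μ) atTop (𝓝 0) := by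
    rw [← lintegral_zero (μ := μ)]
    exact tendsto_lintegral_of_dominated_convergence σ2 hhm
      (fun K => Eventually.of_forall (hle K)) hσ2fin.ne hh0
  -- real versions
  have hfinK : ∀ K, ∫⁻ ω, h K ω ∂μ ≠ ⊤ := fun K =>
    ((lintegral_mono (hle K)).trans_lt hσ2fin).ne
  let H : ℕ → ℝ := fun K => (∫⁻ ω, h K ω ∂μ).toReal
  have hH0 : Tendsto H atTop (𝓝 0) := by
    have := (ENNReal.tendsto_toReal ENNReal.zero_ne_top).comp hint0
    rw [ENNReal.toReal_zero] at this
    exact this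
  have hhint : ∀ K, Integrable (fun ω => (h K ω).toReal) μ := fun K =>
    integrable_toReal_of_lintegral_ne_top (hhm K).aemeasurable (hfinK K)
  have hσint : Integrable (fun ω => (σ2 ω).toReal) μ :=
    integrable_toReal_of_lintegral_ne_top hσm.aemeasurable hσ2fin.ne
  have hHeq : ∀ K, ∫ ω, (h K ω).toReal ∂μ = H K := fun K =>
    integral_toReal (hhm K).aemeasurable (hσfin.mono fun ω hω => (hle K ω).trans_lt hω)
  set c : ℝ := (∫⁻ ω, σ2 ω ∂μ).toReal with hc
  have hσeq : ∫ ω, (σ2 ω).toReal ∂μ = c := integral_toReal hσm.aemeasurable hσfin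
  have hcpos : 0 < c := ENNReal.toReal_pos hσ2pos.ne' hσ2fin.ne
  have e1 := ergodic_bdd T hT (fun ω => c / 2 - (σ2 ω).toReal)
    (measurable_const.sub hσm.ennreal_toReal) ((integrable_const _).sub hσint) (by
      rw [integral_sub (integrable_const _) hσint, hσeq]
      simp
      linarith)
  have e2 : ∀ᵐ ω ∂μ, ∀ K : ℕ, ∃ C : ℝ, ∀ n : ℕ, ∑ i ∈ Finset.range n,
      ((h K (T^[i] ω)).toReal - (H K + 1 / ((K:ℝ) + 1))) ≤ C := by
    rw [ae_all_iff]
    intro K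
    refine ergodic_bdd T hT (fun ω => (h K ω).toReal - (H K + 1 / ((K:ℝ) + 1)))
      ((hhm K).ennreal_toReal.sub measurable_const) ((hhint K).sub (integrable_const _)) ?_
    rw [integral_sub (hhint K) (integrable_const _), hHeq]
    have : 0 < 1 / ((K:ℝ) + 1) := by positivity
    simp only [integral_const, probReal_univ, smul_eq_mul, one_mul]
    linarith
  have e3 : ∀ᵐ ω ∂μ, ∀ i : ℕ, σ2 (T^[i] ω) < ⊤ := by
    rw [ae_all_iff]
    intro i
    exact (hTm.iterate i).quasiMeasurePreserving.ae hσfin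
  filter_upwards [e1, e2, e3] with ω h1 h2 h3
  intro t ht
  obtain ⟨C1, hC1⟩ := h1
  set S : ℕ → ℝ := fun n => ∑ i ∈ Finset.range n, (σ2 (T^[i] ω)).toReal with hS
  have hS0 : ∀ n, 0 ≤ S n := fun n => Finset.sum_nonneg fun i _ => ENNReal.toReal_nonneg
  have hb2 : ∀ n, (b n ω) ^ 2 = S n := fun n => by rw [hb, Real.sq_sqrt (hS0 n)]
  have hSlow : ∀ n : ℕ, (n:ℝ) * (c / 2) - C1 ≤ S n := by
    intro n
    have := hC1 n
    rw [Finset.sum_sub_distrib] at this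
    simp only [Finset.sum_const, Finset.card_range, nsmul_eq_mul] at this
    change _ - S n ≤ _ at this
    linarith
  have hnatlin : ∀ (a d : ℝ), 0 < a → Tendsto (fun n : ℕ => (n:ℝ) * a - d) atTop atTop := by
    intro a d ha
    exact tendsto_atTop_add_const_right _ _ (tendsto_natCast_atTop_atTop.atTop_mul_const ha)
  have hST : Tendsto S atTop atTop :=
    tendsto_atTop_mono hSlow (hnatlin _ _ (by positivity))
  have hbT : Tendsto (fun n => t * b n ω) atTop atTop := by
    have : (fun n => t * b n ω) = fun n => t * Real.sqrt (S n) := by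
      ext n; rw [hb]
    rw [this]
    exact (Real.tendsto_sqrt_atTop.comp hST).const_mul_atTop ht
  have hδ : Tendsto (fun K : ℕ => H K + 1 / ((K:ℝ) + 1)) atTop (𝓝 0) := by
    simpa using hH0.add tendsto_one_div_add_atTop_nhds_zero_nat
  rw [Metric.tendsto_atTop']
  intro ε hε
  obtain ⟨K, hK⟩ := ((hδ.eventually_lt_const (show (0:ℝ) < ε * c / 4 by positivity))).exists
  obtain ⟨C2, hC2⟩ := h2 K
  have ev : ∀ᶠ n : ℕ in atTop, dist ((1 / (b n ω) ^ 2) * ∑ i ∈ Finset.range n,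
            (∫⁻ x in {x : ℝ | t * b n ω < |x - μbar (T^[i] ω)|},
                ENNReal.ofReal ((x - μbar (T^[i] ω)) ^ 2) ∂(ν (T^[i] ω))).toReal) 0 < ε := by
    filter_upwards [hbT.eventually_ge_atTop (K:ℝ), hST.eventually_gt_atTop 0,
      (hnatlin (ε * c / 4) (ε * C1 + C2) (by positivity)).eventually_gt_atTop 0]
      with n hn1 hn2 hn3
    have hnn : 0 ≤ ∑ i ∈ Finset.range n,
            (∫⁻ x in {x : ℝ | t * b n ω < |x - μbar (T^[i] ω)|},
                ENNReal.ofReal ((x - μbar (T^[i] ω)) ^ 2) ∂(ν (T^[i] ω))).toReal :=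
      Finset.sum_nonneg fun i _ => ENNReal.toReal_nonneg
    have hub : ∑ i ∈ Finset.range n,
            (∫⁻ x in {x : ℝ | t * b n ω < |x - μbar (T^[i] ω)|},
                ENNReal.ofReal ((x - μbar (T^[i] ω)) ^ 2) ∂(ν (T^[i] ω))).toReal
          ≤ ∑ i ∈ Finset.range n, (h K (T^[i] ω)).toReal := by
      refine Finset.sum_le_sum fun i _ => ?_
      refine ENNReal.toReal_mono ((hle K _).trans_lt (h3 i)).ne ?_
      refine lintegral_mono_set ?_
      intro x hx
      exact lt_of_le_of_lt hn1 hx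
    have h4 := hC2 n
    rw [Finset.sum_sub_distrib] at h4
    simp only [Finset.sum_const, Finset.card_range, nsmul_eq_mul] at h4
    have h5 : (n:ℝ) * (H K + 1 / ((K:ℝ) + 1)) ≤ n * (ε * c / 4) :=
      mul_le_mul_of_nonneg_left hK.le (Nat.cast_nonneg n)
    have h6 := mul_le_mul_of_nonneg_left (hSlow n) hε.le
    rw [hb2, Real.dist_0_eq_abs, abs_of_nonneg (by positivity), one_div, inv_mul_lt_iff₀ hn2]
    linarith
  obtain ⟨N, hN⟩ := eventually_atTop.1 ev
  exact ⟨N, fun n hn => hN n hn.le⟩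
end

section
/- Let (E, μ) be a probability space, T : E → E an ergodic measure-preserving transformation, and ω ↦ ν(ω) a measurable kernel assigning to each ω ∈ E a probability measure on ℕ. Let m(ω) = Σ_k k ν(ω)({k}) and assume 0 < m(ω) < ∞ for μ-a.e. ω and ∫_E log m dμ ∈ (0, ∞). Set P_n(ω) = ∏_{i=0}^{n−1} m(T^iω). Fix κ > 0 and β ≥ 0, and set m̃_n(ω) = Σ_k k · 1{k (log⁺ k)^κ ≤ P_{n+1}(ω)} ν(T^nω)({k}). If ∫_E (1/m(ω)) Σ_k k (log⁺ k)^{1+β} ν(ω)({k}) μ(dω) < ∞, then for μ-a.e. ω the series Σ_{n≥1} n^β (1 − m̃_n(ω)/m(T^nω)) converges. -/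
open MeasureTheory Filter Topology
open scoped ENNReal NNReal

/-- `log⁺ x = max (log x) 0`. -/
noncomputable def logPos (x : ℝ) : ℝ := max (Real.log x) 0

/-- running maxima of Birkhoff sums -/
noncomputable def auxM {E : Type*} (T : E → E) (g : E → ℝ) : ℕ → E → ℝ
  | 0 => fun _ => 0
  | n + 1 => fun ω => max 0 (g ω + auxM T g n (T ω))

lemma auxM_nonneg {E : Type*} (T : E → E) (g : E → ℝ) (n : ℕ) (ω : E) : 0 ≤ auxM T g n ω := by
  cases n with
  | zero => simp [auxM]
  | succ n => simp [auxM]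

lemma auxM_succ_le {E : Type*} (T : E → E) (g : E → ℝ) (n : ℕ) :
    ∀ ω, auxM T g n ω ≤ auxM T g (n + 1) ω := by
  induction n with
  | zero => intro ω; exact auxM_nonneg T g 1 ω
  | succ n ih =>
    intro ω
    have := ih (T ω)
    change max 0 (g ω + auxM T g n (T ω)) ≤ max 0 (g ω + auxM T g (n + 1) (T ω))
    gcongr

lemma auxM_mono {E : Type*} (T : E → E) (g : E → ℝ) (ω : E) : Monotone (fun n => auxM T g n ω) :=
  monotone_nat_of_le_succ (fun n => auxM_succ_le T g n ω)

lemma sum_le_auxM {E : Type*} (T : E → E) (g : E → ℝ) (n : ℕ) :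
    ∀ ω, birkhoffSum T g n ω ≤ auxM T g n ω := by
  induction n with
  | zero => intro ω; simp [auxM]
  | succ n ih =>
    intro ω
    rw [birkhoffSum_succ']
    exact le_trans (by have := ih (T ω); linarith) (le_max_right _ _)

lemma auxM_measurable {E : Type*} [MeasurableSpace E] {T : E → E} (hT : Measurable T)
    {g : E → ℝ} (hg : Measurable g) (n : ℕ) : Measurable (auxM T g n) := by
  induction n with
  | zero => exact measurable_const
  | succ n ih => exact measurable_const.max (hg.add (ih.comp hT))

lemma auxM_integrable {E : Type*} [MeasurableSpace E] {μ : Measure E} [IsProbabilityMeasure μ]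
    {T : E → E} (hT : MeasurePreserving T μ μ)
    {g : E → ℝ} (hg : Integrable g μ) (n : ℕ) : Integrable (auxM T g n) μ := by
  induction n with
  | zero => exact integrable_zero _ _ _
  | succ n ih =>
    exact (integrable_zero E ℝ μ).sup (hg.add (hT.integrable_comp_of_integrable ih))

lemma auxM_bdd {E : Type*} [MeasurableSpace E] {μ : Measure E} [IsProbabilityMeasure μ]
    {T : E → E} (hT : Ergodic T μ) {g : E → ℝ} (hgm : Measurable g) (hg : Integrable g μ)
    (hneg : ∫ ω, g ω ∂μ < 0) :
    ∀ᵐ ω ∂μ, BddAbove (Set.range fun n => auxM T g n ω) := by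
  have hTp := hT.toMeasurePreserving
  have hmeas : MeasurableSet {ω | BddAbove (Set.range fun n => auxM T g n ω)} :=
    measurableSet_bddAbove_range (fun n => auxM_measurable hTp.measurable hgm n)
  have hinv : T ⁻¹' {ω | BddAbove (Set.range fun n => auxM T g n ω)}
      = {ω | BddAbove (Set.range fun n => auxM T g n ω)} := by
    ext ω
    simp only [Set.mem_preimage, Set.mem_ofPred_eq]
    constructor
    · rintro ⟨C, hC⟩
      refine ⟨max 0 (g ω + C), ?_⟩
      rintro _ ⟨n, rfl⟩
      have := hC ⟨n, rfl⟩
      dsimp only at this ⊢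
      refine (auxM_succ_le T g n ω).trans ?_
      change max 0 (g ω + auxM T g n (T ω)) ≤ _
      gcongr
    · rintro ⟨C, hC⟩
      refine ⟨C - g ω, ?_⟩
      rintro _ ⟨n, rfl⟩
      have h1 : max 0 (g ω + auxM T g n (T ω)) ≤ C := hC ⟨n + 1, rfl⟩
      have := (le_max_right _ _).trans h1
      dsimp only
      linarith
  rcases hT.toPreErgodic.ae_empty_or_univ hmeas hinv with h | h
  · exfalso
    have hlim : Tendsto (fun n => ∫ ω, (auxM T g (n + 1) ω - auxM T g n (T ω)) ∂μ) atTop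
        (𝓝 (∫ ω, g ω ∂μ)) := by
      refine tendsto_integral_of_dominated_convergence (fun ω => |g ω|) ?_ hg.abs ?_ ?_
      · intro n
        exact ((auxM_measurable hTp.measurable hgm (n + 1)).sub
          ((auxM_measurable hTp.measurable hgm n).comp hTp.measurable)).aestronglyMeasurable
      · intro n
        refine Eventually.of_forall fun ω => ?_
        have h0 := auxM_nonneg T g n (T ω)
        change |max 0 (g ω + auxM T g n (T ω)) - auxM T g n (T ω)| ≤ |g ω|
        rcases max_cases 0 (g ω + auxM T g n (T ω)) with ⟨h1, h2⟩ | ⟨h1, h2⟩ <;> rw [h1]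
        · rw [abs_of_nonpos (by linarith), abs_of_nonpos (by linarith)]; linarith
        · rw [add_sub_cancel_right]
      · filter_upwards [h] with ω hω
        have hω' : ¬ BddAbove (Set.range fun n => auxM T g n ω) := fun hb =>
          (show (Set.ofPred fun ω => BddAbove (Set.range fun n => auxM T g n ω)) ω =
            (∅ : Set E) ω from hω).mp hb
        have hω2 : ¬ BddAbove (Set.range fun n => auxM T g n (T ω)) := by
          intro hb
          exact hω' ((Set.ext_iff.mp hinv ω).mp hb)
        have htop := tendsto_atTop_atTop_of_monotone (auxM_mono T g (T ω)) (by
          intro b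
          by_contra hcon
          push Not at hcon
          exact hω2 ⟨b, by rintro _ ⟨n, rfl⟩; exact (hcon n).le⟩)
        refine tendsto_const_nhds.congr' ?_
        filter_upwards [htop.eventually_ge_atTop (-g ω)] with n hn
        change g ω = max 0 (g ω + auxM T g n (T ω)) - auxM T g n (T ω)
        rw [max_eq_right (by linarith)]; ring
    have hge : 0 ≤ ∫ ω, g ω ∂μ := by
      refine ge_of_tendsto' hlim fun n => ?_
      have hi := auxM_integrable hTp hg
      have hi2 : Integrable (fun ω => auxM T g n (T ω)) μ :=
        hTp.integrable_comp_of_integrable (hi n)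
      rw [integral_sub (hi (n + 1)) hi2]
      have : ∫ ω, auxM T g n (T ω) ∂μ = ∫ ω, auxM T g n ω ∂μ := by
        have h2 := integral_map (μ := μ) hTp.measurable.aemeasurable (f := auxM T g n)
          (auxM_measurable hTp.measurable hgm n).aestronglyMeasurable
        rw [hTp.map_eq] at h2
        exact h2.symm
      rw [this, sub_nonneg]
      exact integral_mono (hi n) (hi (n + 1)) (auxM_succ_le T g n)
    linarith
  · filter_upwards [h] with ω hω
    exact (show (Set.ofPred fun ω => BddAbove (Set.range fun n => auxM T g n ω)) ω =
            (Set.univ : Set E) ω from hω).mpr trivial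

/-- one-sided ergodic theorem, weak form -/
lemma birkhoff_lower {E : Type*} [MeasurableSpace E] {μ : Measure E} [IsProbabilityMeasure μ]
    {T : E → E} (hT : Ergodic T μ) {f : E → ℝ} (hfm : Measurable f) (hf : Integrable f μ)
    {c : ℝ} (hc : c < ∫ ω, f ω ∂μ) :
    ∀ᵐ ω ∂μ, ∃ C : ℝ, ∀ n : ℕ, c * n - C ≤ ∑ i ∈ Finset.range n, f (T^[i] ω) := by
  have hg : Integrable (fun ω => c - f ω) μ := (integrable_const c).sub hf
  have := auxM_bdd hT (g := fun ω => c - f ω) (measurable_const.sub hfm) hg (by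
    rw [integral_sub (integrable_const c) hf]; simp; linarith)
  filter_upwards [this] with ω ⟨C, hC⟩
  refine ⟨C, fun n => ?_⟩
  have h1 := (sum_le_auxM T (fun ω => c - f ω) n ω).trans (hC ⟨n, rfl⟩)
  simp only [birkhoffSum, Finset.sum_sub_distrib, Finset.sum_const, Finset.card_range,
    nsmul_eq_mul] at h1
  linarith

lemma weight_sum (β : ℝ) (hβ : 0 ≤ β) (c : ℝ) (hc : 0 < c) (L : ℝ) (hL : 0 ≤ L) :
    ∑' n : ℕ, (if c * (n + 1 : ℕ) ≤ L then ENNReal.ofReal (((n + 1 : ℕ) : ℝ) ^ β) else 0)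
      ≤ ENNReal.ofReal (c⁻¹ ^ (1 + β)) * ENNReal.ofReal (L ^ (1 + β)) := by
  set x : ℝ := c⁻¹ * L with hx
  have hx0 : 0 ≤ x := by positivity
  have hiff : ∀ n : ℕ, c * (n + 1 : ℕ) ≤ L ↔ n ∈ Finset.range ⌊x⌋₊ := by
    intro n
    rw [Finset.mem_range, Nat.lt_iff_add_one_le, Nat.le_floor_iff hx0, hx,
      le_inv_mul_iff₀ hc]
  rw [tsum_eq_sum (s := Finset.range ⌊x⌋₊)
    (fun n hn => if_neg (fun h => hn ((hiff n).mp h)))]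
  rw [← ENNReal.ofReal_mul (by positivity), ← Real.mul_rpow (by positivity) hL, ← hx]
  calc _ ≤ ∑ n ∈ Finset.range ⌊x⌋₊, ENNReal.ofReal (x ^ β) := by
        refine Finset.sum_le_sum fun n hn => ?_
        rw [if_pos ((hiff n).mpr hn)]
        refine ENNReal.ofReal_le_ofReal (Real.rpow_le_rpow (by positivity) ?_ hβ)
        rw [← Nat.le_floor_iff hx0]
        exact Finset.mem_range.mp hn
    _ = ENNReal.ofReal (⌊x⌋₊ * x ^ β) := by
        rw [Finset.sum_const, Finset.card_range, nsmul_eq_mul,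
          ENNReal.ofReal_mul (by positivity), ENNReal.ofReal_natCast]
    _ ≤ ENNReal.ofReal (x ^ (1 + β)) := by
        refine ENNReal.ofReal_le_ofReal ?_
        rw [Real.rpow_add_of_nonneg hx0 zero_le_one hβ, Real.rpow_one]
        exact mul_le_mul_of_nonneg_right (Nat.floor_le hx0) (by positivity)

lemma log_bound {κ : ℝ} (hκ : 0 < κ) (k : ℕ) {p : ℝ} (h : Real.exp p < (k : ℝ) * logPos k ^ κ) :
    p ≤ (1 + κ) * logPos k := by
  have hp := Real.exp_pos p
  have hk : 0 < (k : ℝ) := by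
    rcases Nat.eq_zero_or_pos k with h0 | h0
    · subst h0; simp at h; linarith
    · exact_mod_cast h0
  have hL0 : 0 ≤ logPos k := le_max_right _ _
  have hL : 0 < logPos k := by
    rcases hL0.lt_or_eq with h1 | h1
    · exact h1
    · rw [← h1, Real.zero_rpow hκ.ne'] at h; simp at h; linarith
  have h2 : p < Real.log ((k : ℝ) * logPos k ^ κ) := (Real.lt_log_iff_exp_lt (hp.trans h)).mpr h
  rw [Real.log_mul hk.ne' (by positivity), Real.log_rpow hL] at h2
  have h3 : Real.log (logPos k) ≤ logPos k := by
    have := Real.log_le_sub_one_of_pos hL; linarith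
  have h4 : Real.log k ≤ logPos k := le_max_left _ _
  nlinarith

/-- **Truncation estimate in a stationary ergodic random environment** (Lemma 11.1):
for a branching random walk in a stationary ergodic random environment with quenched
offspring law `ν(T^nω)`, quenched means `m(T^nω)` and quenched mean population sizes
`P_n(ω)`, the annealed moment condition `E[(N/m₀)(log⁺N)^{1+β}] < ∞` implies that for
a.e. environment the truncation series `Σ n^β (1 − m̃_n(ω)/m(T^nω))` converges. -/
theorem truncation_series_summable_random_env
    {E : Type*} [MeasurableSpace E] (μ : Measure E) [IsProbabilityMeasure μ]
    (T : E → E) (hT : Ergodic T μ)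
    (ν : E → Measure ℕ) (hνmeas : Measurable ν)
    [hνprob : ∀ ω, IsProbabilityMeasure (ν ω)]
    (mL : E → ℝ≥0∞) (hmL : ∀ ω, mL ω = ∑' k : ℕ, (k : ℝ≥0∞) * ν ω {k})
    (hmpos : ∀ᵐ ω ∂μ, 0 < mL ω ∧ mL ω < ⊤)
    (hlogInt : Integrable (fun ω => Real.log (mL ω).toReal) μ)
    (hlogPos : 0 < ∫ ω, Real.log (mL ω).toReal ∂μ)
    (Pn : ℕ → E → ℝ)
    (hPn : ∀ n ω, Pn n ω = ∏ i ∈ Finset.range n, (mL (T^[i] ω)).toReal)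
    (κ : ℝ) (hκ : 0 < κ) (β : ℝ) (hβ : 0 ≤ β)
    (mt : ℕ → E → ℝ)
    (hmt : ∀ n ω, mt n ω = ∑' k : ℕ,
      (if (k : ℝ) * logPos k ^ κ ≤ Pn (n + 1) ω
        then (k : ℝ) * (ν (T^[n] ω) {k}).toReal else 0))
    (hmom : (∫⁻ ω, (mL ω)⁻¹ *
        ∑' k : ℕ, (k : ℝ≥0∞) * ENNReal.ofReal (logPos k ^ ((1 : ℝ) + β)) * ν ω {k} ∂μ)
      < ⊤) :
    ∀ᵐ ω ∂μ, Summable (fun n : ℕ =>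
      (n : ℝ) ^ β * (1 - mt n ω / (mL (T^[n] ω)).toReal)) := by
  have hνk : ∀ k : ℕ, Measurable (fun ω => ν ω {k}) := fun k =>
    (Measure.measurable_coe (MeasurableSet.singleton k)).comp hνmeas
  have hmLm : Measurable mL := by
    rw [show mL = fun ω => ∑' k : ℕ, (k : ℝ≥0∞) * ν ω {k} from funext hmL]
    exact Measurable.ennreal_tsum fun k => (hνk k).const_mul _
  have hTp := hT.toMeasurePreserving
  have hlm : Measurable (fun ω => Real.log (mL ω).toReal) :=
    Real.measurable_log.comp hmLm.ennreal_toReal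
  set a := ∫ ω, Real.log (mL ω).toReal ∂μ with ha
  have hbir := birkhoff_lower hT hlm hlogInt (c := a / 2) (by linarith)
  -- constant
  set c : ℝ := a / 4 / (1 + κ) with hc
  have hc0 : 0 < c := by positivity
  set G : ℕ → E → ℝ≥0∞ := fun n ω => (mL ω)⁻¹ *
    ∑' k : ℕ, (if c * n ≤ logPos k then (k : ℝ≥0∞) * ν ω {k} else 0) with hG
  have hGm : ∀ n, Measurable (G n) := by
    intro n
    refine hmLm.inv.mul (Measurable.ennreal_tsum fun k => ?_)
    split_ifs
    · exact (hνk k).const_mul _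
    · exact measurable_const
  have hfin : ∀ᵐ ω ∂μ, ∑' n : ℕ, ENNReal.ofReal (((n + 1 : ℕ) : ℝ) ^ β) * G (n + 1) (T^[n + 1] ω)
      < ⊤ := by
    refine ae_lt_top (Measurable.ennreal_tsum fun n =>
      ((hGm (n + 1)).comp (hTp.iterate (n + 1)).measurable).const_mul _) (ne_of_lt ?_)
    have h0 : ∀ n : ℕ, AEMeasurable (fun ω => ENNReal.ofReal (((n + 1 : ℕ) : ℝ) ^ β) *
        G (n + 1) (T^[n + 1] ω)) μ := fun n =>
      (((hGm (n + 1)).comp (hTp.iterate (n + 1)).measurable).const_mul _).aemeasurable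
    rw [lintegral_tsum h0]
    have h1 : ∀ n : ℕ, ∫⁻ ω, ENNReal.ofReal (((n + 1 : ℕ) : ℝ) ^ β) * G (n + 1) (T^[n + 1] ω) ∂μ
        = ∫⁻ ω, ENNReal.ofReal (((n + 1 : ℕ) : ℝ) ^ β) * G (n + 1) ω ∂μ := fun n =>
      (hTp.iterate (n + 1)).lintegral_comp ((hGm (n + 1)).const_mul _)
    simp_rw [h1]
    rw [← lintegral_tsum (fun n => ((hGm (n + 1)).const_mul _).aemeasurable)]
    refine lt_of_le_of_lt (b := ∫⁻ ω, ENNReal.ofReal (c⁻¹ ^ (1 + β)) * ((mL ω)⁻¹ *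
        ∑' k : ℕ, (k : ℝ≥0∞) * ENNReal.ofReal (logPos k ^ ((1 : ℝ) + β)) * ν ω {k}) ∂μ) ?_ ?_
    · refine lintegral_mono fun ω => ?_
      dsimp only [G]
      have h2 : ∀ n : ℕ, ENNReal.ofReal (((n + 1 : ℕ) : ℝ) ^ β) * ((mL ω)⁻¹ *
          ∑' k : ℕ, (if c * (n + 1 : ℕ) ≤ logPos k then (k : ℝ≥0∞) * ν ω {k} else 0))
          = (mL ω)⁻¹ * ∑' k : ℕ, ((k : ℝ≥0∞) * ν ω {k}) *
            (if c * (n + 1 : ℕ) ≤ logPos k then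
              ENNReal.ofReal (((n + 1 : ℕ) : ℝ) ^ β) else 0) := by
        intro n
        rw [mul_left_comm, ← ENNReal.tsum_mul_left]
        congr 2
        ext k
        split_ifs
        · rw [mul_comm]
        · simp
      simp_rw [h2]
      rw [ENNReal.tsum_mul_left, ENNReal.tsum_comm, mul_left_comm]
      refine mul_le_mul_right ?_ _
      rw [← ENNReal.tsum_mul_left]
      refine ENNReal.tsum_le_tsum fun k => ?_
      rw [ENNReal.tsum_mul_left]
      calc _ ≤ ((k : ℝ≥0∞) * ν ω {k}) *
            (ENNReal.ofReal (c⁻¹ ^ (1 + β)) * ENNReal.ofReal (logPos k ^ (1 + β))) := by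
            gcongr
            exact weight_sum β hβ c hc0 (logPos k) (le_max_right _ _)
        _ = _ := by ring
    · rw [lintegral_const_mul]
      · exact ENNReal.mul_lt_top ENNReal.ofReal_lt_top hmom
      · exact hmLm.inv.mul (Measurable.ennreal_tsum fun k => (hνk k).const_mul _)
  have hpos : ∀ᵐ ω ∂μ, ∀ n : ℕ, 0 < mL (T^[n] ω) ∧ mL (T^[n] ω) < ⊤ :=
    ae_all_iff.mpr fun n => (hTp.iterate n).quasiMeasurePreserving.ae hmpos
  filter_upwards [hbir, hfin, hpos] with ω ⟨C, hC⟩ hF hP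
  have hPexp : ∀ n : ℕ, Real.exp (a / 2 * n - C) ≤ Pn n ω := by
    intro n
    rw [hPn, ← Real.le_log_iff_exp_le (Finset.prod_pos fun i _ =>
      ENNReal.toReal_pos (hP i).1.ne' (hP i).2.ne), Real.log_prod (fun i _ =>
      (ENNReal.toReal_pos (hP i).1.ne' (hP i).2.ne).ne')]
    exact hC n
  rw [← summable_nat_add_iff 1]
  refine Summable.of_norm_bounded_eventually_nat (ENNReal.summable_toReal hF.ne) ?_
  obtain ⟨N, hN⟩ := exists_nat_ge (C / (a / 4))
  filter_upwards [eventually_ge_atTop N] with n hn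
  generalize hj : n + 1 = j
  have hjN : C ≤ a / 4 * j := by
    rw [div_le_iff₀ (by positivity)] at hN
    have : (N : ℝ) ≤ j := by exact_mod_cast (by omega : N ≤ j)
    nlinarith
  obtain ⟨hm0, hmt'⟩ := hP j
  set ω' := T^[j] ω with hω'
  set p := Pn (j + 1) ω with hp
  set A : ℝ≥0∞ := ∑' k : ℕ, (if (k : ℝ) * logPos k ^ κ ≤ p then (k : ℝ≥0∞) * ν ω' {k} else 0)
    with hA
  set B : ℝ≥0∞ := ∑' k : ℕ, (if (k : ℝ) * logPos k ^ κ ≤ p then 0 else (k : ℝ≥0∞) * ν ω' {k})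
    with hB
  have hAB : A + B = mL ω' := by
    rw [hA, hB, ← ENNReal.tsum_add, hmL]
    congr 1
    ext k
    split_ifs <;> simp
  have hAt : A ≠ ⊤ := ((le_self_add.trans hAB.le).trans_lt hmt').ne
  have hBt : B ≠ ⊤ := ((le_add_self.trans hAB.le).trans_lt hmt').ne
  have hmtA : mt j ω = A.toReal := by
    rw [hmt, hA, ENNReal.tsum_toReal_eq]
    · refine tsum_congr fun k => ?_
      rw [← hp, ← hω']
      split_ifs <;> simp
    · intro k
      split_ifs
      · exact ENNReal.mul_ne_top (by simp) (measure_ne_top _ _)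
      · simp
  have hmr : 0 < (mL ω').toReal := ENNReal.toReal_pos hm0.ne' hmt'.ne
  have hBr : 1 - mt j ω / (mL ω').toReal = ((mL ω')⁻¹ * B).toReal := by
    rw [hmtA, ENNReal.toReal_mul, ENNReal.toReal_inv]
    have : (mL ω').toReal = A.toReal + B.toReal := by
      rw [← hAB, ENNReal.toReal_add hAt hBt]
    field_simp
    linarith
  have hBG : (mL ω')⁻¹ * B ≤ G j ω' := by
    dsimp only [G]
    refine mul_le_mul_right (ENNReal.tsum_le_tsum fun k => ?_) _
    split_ifs with h1 h2 h2
    · simp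
    · simp
    · exact le_rfl
    · exfalso
      apply h2
      have h3 := log_bound hκ k ((hPexp (j + 1)).trans_lt (not_le.mp h1))
      rw [hc, div_mul_eq_mul_div, div_le_iff₀ (by positivity)]
      push_cast at h3
      nlinarith
  have hGt : G j ω' ≠ ⊤ := by
    refine ENNReal.mul_ne_top (ENNReal.inv_ne_top.mpr hm0.ne') (ne_of_lt ?_)
    refine lt_of_le_of_lt ?_ hmt'
    rw [hmL]
    gcongr with k
    split_ifs
    · exact le_rfl
    · simp
  rw [hBr, Real.norm_of_nonneg (by positivity), ENNReal.toReal_mul (a := ENNReal.ofReal _),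
    ENNReal.toReal_ofReal (by positivity)]
  exact mul_le_mul_of_nonneg_left (ENNReal.toReal_mono hGt hBG) (by positivity)
end

section
/- Let Y be a nonnegative random variable on a probability space with E Y = 1 and E Y² < ∞. Then E[Y log⁺ Y] ≤ 1 + log⁺(E Y²). -/
open MeasureTheory

/-- **Size-biasing inequality** (from the proof of Lemma 4.2): if `Y ≥ 0` a.s.,
`E Y = 1` and `E Y² < ∞`, then `E[Y log⁺Y] ≤ 1 + log⁺(E Y²)`. -/
theorem sizeBiased_log_bound
    {Ω : Type*} [MeasurableSpace Ω] (P : Measure Ω) [IsProbabilityMeasure P]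
    (Y : Ω → ℝ) (hYmeas : Measurable Y) (hYpos : ∀ᵐ ω ∂P, 0 ≤ Y ω)
    (hYint : Integrable Y P) (hYmean : ∫ ω, Y ω ∂P = 1)
    (hY2int : Integrable (fun ω => Y ω ^ 2) P) :
    ∫ ω, Y ω * logPos (Y ω) ∂P ≤ 1 + logPos (∫ ω, Y ω ^ 2 ∂P) := by
  set m := ∫ ω, Y ω ^ 2 ∂P with hm
  have hm1 : 1 ≤ m := by
    have h0 : 0 ≤ ∫ ω, (Y ω ^ 2 - (2 * Y ω - 1)) ∂P :=
      integral_nonneg (fun ω => by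
        show (0 : ℝ) ≤ Y ω ^ 2 - (2 * Y ω - 1)
        nlinarith [sq_nonneg (Y ω - 1)])
    have h2 : Integrable (fun ω => 2 * Y ω) P := hYint.const_mul 2
    have h3 : Integrable (fun ω => 2 * Y ω - 1) P := h2.sub (integrable_const 1)
    rw [integral_sub hY2int h3,
      integral_sub h2 (integrable_const 1), integral_const_mul, hYmean] at h0
    simp at h0
    linarith
  have hm0 : 0 < m := by linarith
  have hlm : 0 ≤ Real.log m := Real.log_nonneg hm1
  have hi1 : Integrable (fun ω => Y ω * Real.log m) P := hYint.mul_const _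
  have hi2 : Integrable (fun ω => Y ω ^ 2 / m) P := hY2int.div_const _
  have key : ∫ ω, Y ω * logPos (Y ω) ∂P ≤ ∫ ω, (Y ω * Real.log m + Y ω ^ 2 / m) ∂P := by
    apply integral_mono_of_nonneg
    · filter_upwards [hYpos] with ω h
      exact mul_nonneg h (le_max_right _ _)
    · exact hi1.add hi2
    · filter_upwards [hYpos] with ω h
      have hb : logPos (Y ω) ≤ Real.log m + Y ω / m := by
        have hd : 0 ≤ Y ω / m := div_nonneg h hm0.le
        refine max_le ?_ (by positivity)
        rcases h.eq_or_lt with h | h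
        · rw [← h]; simpa using hlm
        · have := Real.log_le_sub_one_of_pos (div_pos h hm0)
          rw [Real.log_div h.ne' hm0.ne'] at this
          linarith
      calc Y ω * logPos (Y ω) ≤ Y ω * (Real.log m + Y ω / m) :=
            mul_le_mul_of_nonneg_left hb h
        _ = Y ω * Real.log m + Y ω ^ 2 / m := by ring
  rw [integral_add hi1 hi2, integral_mul_const, integral_div, hYmean, ← hm,
    div_self hm0.ne'] at key
  have : Real.log m ≤ logPos m := le_max_left _ _
  linarith
end

section
/- Define l : ℝ → ℝ by l(x) = x/e if x < e and l(x) = log x if x ≥ e. Then l is concave on ℝ, and for every x ≥ 0 one has log⁺ x ≤ l(x) ≤ 1 + log⁺ x. -/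
/-- **The concave majorant of `log⁺`** (auxiliary construction in the proof of
Lemma 4.2): `l(x) = x/e` for `x < e` and `l(x) = log x` for `x ≥ e` is concave on `ℝ`
and satisfies `log⁺ x ≤ l(x) ≤ 1 + log⁺ x` for all `x ≥ 0`. -/
theorem concave_majorant_of_logPos
    (l : ℝ → ℝ)
    (hl : ∀ x : ℝ, l x = if x < Real.exp 1 then x / Real.exp 1 else Real.log x) :
    ConcaveOn ℝ Set.univ l ∧ ∀ x : ℝ, 0 ≤ x → logPos x ≤ l x ∧ l x ≤ 1 + logPos x := by
  have he : 0 < Real.exp 1 := Real.exp_pos 1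
  have key : ∀ m y : ℝ, Real.exp 1 ≤ m → l y ≤ y / m + (Real.log m - 1) := by
    intro m y hm
    have hm0 : 0 < m := he.trans_le hm
    rw [hl]
    split_ifs with hy
    · have h1 := Real.log_le_sub_one_of_pos (div_pos he hm0)
      rw [Real.log_div he.ne' hm0.ne', Real.log_exp] at h1
      have h2 : 0 ≤ (Real.exp 1 - y) * (1 / Real.exp 1 - 1 / m) :=
        mul_nonneg (by linarith) (sub_nonneg.2 (one_div_le_one_div_of_le he hm))
      have h3 : (Real.exp 1 - y) * (1 / Real.exp 1 - 1 / m)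
          = 1 - Real.exp 1 / m - y / Real.exp 1 + y / m := by
        field_simp
        ring
      linarith
    · have hy0 : 0 < y := he.trans_le (not_lt.1 hy)
      have h1 := Real.log_le_sub_one_of_pos (div_pos hy0 hm0)
      rw [Real.log_div hy0.ne' hm0.ne'] at h1
      linarith
  have eqz : ∀ z : ℝ, ∃ m, Real.exp 1 ≤ m ∧ l z = z / m + (Real.log m - 1) := by
    intro z
    by_cases hz : z < Real.exp 1
    · refine ⟨Real.exp 1, le_rfl, ?_⟩
      rw [hl, if_pos hz, Real.log_exp]
      ring
    · have hz' := not_lt.1 hz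
      refine ⟨z, hz', ?_⟩
      rw [hl, if_neg hz, div_self (he.trans_le hz').ne']
      ring
  refine ⟨⟨convex_univ, ?_⟩, ?_⟩
  · intro x _ y _ a b ha hb hab
    obtain ⟨m, hm, h⟩ := eqz (a • x + b • y)
    rw [h]
    simp only [smul_eq_mul]
    have h1 := mul_le_mul_of_nonneg_left (key m x hm) ha
    have h2 := mul_le_mul_of_nonneg_left (key m y hm) hb
    have h3 : a * (x / m + (Real.log m - 1)) + b * (y / m + (Real.log m - 1))
        = (a * x + b * y) / m + (a + b) * (Real.log m - 1) := by ring
    rw [hab, one_mul] at h3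
    linarith
  · intro x hx
    rw [hl]
    unfold logPos
    split_ifs with h
    · have h0 : 0 ≤ x / Real.exp 1 := by positivity
      refine ⟨max_le ?_ h0, ?_⟩
      · rcases hx.eq_or_lt with rfl | hx0
        · simp
        · have h1 := Real.log_le_sub_one_of_pos (div_pos hx0 he)
          rw [Real.log_div hx0.ne' he.ne', Real.log_exp] at h1
          linarith
      · have := (div_le_one he).2 h.le
        linarith [le_max_right (Real.log x) 0]
    · have h1 : 1 ≤ x := (Real.one_le_exp zero_le_one).trans (not_lt.1 h)
      exact ⟨max_le le_rfl (Real.log_nonneg h1), by linarith [le_max_left (Real.log x) 0]⟩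
end
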